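/- arXiv:1403.7814 — 6 statements merged into one kernel-verified Lean document; each statement's English description precedes it below -/
import Mathlib

section
/- Let (U_n)_{n≥1} be a sequence of random matrices defined on a common probability space such that for each n, U_n is distributed according to the normalized Haar measure on U(n) (no independence assumption is needed). For each n let Z_n(z) = det(z·I − U_n) and let Im log Z_n be the branch of the argument of Z_n defined below. Then almost surely, limsup_{n→∞} (1/log n) · sup{ |Im log Z_n(e^{iθ})| : θ ∈ [0, 2π), e^{iθ} not an eigenvalue of U_n } ≤ √2. -/
open MeasureTheory Matrix Complex Real Filter

noncomputable instance (n : ℕ) : MeasurableSpace (Matrix.unitaryGroup (Fin n) ℂ) :=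
  borel _

instance (n : ℕ) : BorelSpace (Matrix.unitaryGroup (Fin n) ℂ) := ⟨rfl⟩

namespace ArgMax

open scoped Topology

/-- Sum of the arguments of `1 - l` over the eigenvalues. -/
noncomputable def TT {n : ℕ} (A : Matrix (Fin n) (Fin n) ℂ) : ℝ :=
  (A.charpoly.roots.map fun l => (Complex.log (1 - l)).im).sum

/-- The branch of the logarithm of `det (1 - r A)`. -/
noncomputable def LL {n : ℕ} (A : Matrix (Fin n) (Fin n) ℂ) (r : ℝ) : ℂ :=
  (A.charpoly.roots.map fun l => Complex.log (1 - r * l)).sum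

lemma charpoly_eq {n : ℕ} (A : Matrix (Fin n) (Fin n) ℂ) :
    A.charpoly = (A.charpoly.roots.map fun a => Polynomial.X - Polynomial.C a).prod := by
  have h := IsAlgClosed.splits A.charpoly
  have := h.eq_prod_roots
  rw [A.charpoly_monic.leadingCoeff] at this
  simpa using this

lemma card_roots {n : ℕ} (A : Matrix (Fin n) (Fin n) ℂ) :
    Multiset.card A.charpoly.roots = n := by
  have h := IsAlgClosed.splits A.charpoly
  have := h.natDegree_eq_card_roots
  rw [Matrix.charpoly_natDegree_eq_dim] at this
  simpa using this.symm

lemma det_sub {n : ℕ} (A : Matrix (Fin n) (Fin n) ℂ) (x : ℂ) :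
    (Matrix.scalar (Fin n) x - A).det = (A.charpoly.roots.map fun a => x - a).prod := by
  rw [← Matrix.eval_charpoly]
  conv_lhs => rw [charpoly_eq A]
  rw [Polynomial.eval_multiset_prod, Multiset.map_map]
  simp

lemma det_one_sub {n : ℕ} (A : Matrix (Fin n) (Fin n) ℂ) (z : ℂ) :
    (1 - z • A).det = (A.charpoly.roots.map fun a => 1 - z * a).prod := by
  by_cases hz : z = 0
  · simp [hz]
  have h1 : (1 - z • A) = z • (Matrix.scalar (Fin n) z⁻¹ - A) := by
    rw [smul_sub]
    congr 1
    ext i j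
    by_cases hij : i = j <;> simp [Matrix.one_apply, hij, hz]
  rw [h1, Matrix.det_smul, det_sub]
  have h2 : z ^ (Fintype.card (Fin n)) = (A.charpoly.roots.map fun _ => z).prod := by
    simp [card_roots]
  rw [h2, ← Multiset.prod_map_mul]
  congr 1
  apply Multiset.map_congr rfl
  intro a _
  field_simp

lemma roots_smul {n : ℕ} (A : Matrix (Fin n) (Fin n) ℂ) (c : ℂ) (hc : c ≠ 0) :
    (c • A).charpoly.roots = A.charpoly.roots.map fun a => c * a := by
  have : (c • A).charpoly =
      ((A.charpoly.roots.map fun a => c * a).map fun a => Polynomial.X - Polynomial.C a).prod := by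
    apply Polynomial.funext
    intro x
    rw [Matrix.eval_charpoly, Polynomial.eval_multiset_prod, Multiset.map_map, Multiset.map_map]
    have h1 : Matrix.scalar (Fin n) x - c • A = c • (Matrix.scalar (Fin n) (c⁻¹ * x) - A) := by
      rw [smul_sub]
      congr 1
      ext i j
      by_cases hij : i = j <;> simp [hij, hc]
    rw [h1, Matrix.det_smul, det_sub]
    have h2 : c ^ (Fintype.card (Fin n)) = (A.charpoly.roots.map fun _ => c).prod := by
      simp [card_roots]
    rw [h2, ← Multiset.prod_map_mul]
    congr 1
    apply Multiset.map_congr rfl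
    intro a _
    simp
    field_simp
  rw [this, Polynomial.roots_multiset_prod_X_sub_C]

open scoped Matrix.Norms.L2Operator in
lemma norm_root {n : ℕ} (A : Matrix (Fin n) (Fin n) ℂ) (hA : A ∈ Matrix.unitaryGroup (Fin n) ℂ)
    {l : ℂ} (hl : l ∈ A.charpoly.roots) : ‖l‖ = 1 := by
  have h1 : l ∈ spectrum ℂ A :=
    Matrix.mem_spectrum_of_isRoot_charpoly (Polynomial.isRoot_of_mem_roots hl)
  have := Unitary.spectrum_subset_circle (𝕜 := ℂ) ⟨A, hA⟩ h1
  simpa using this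

lemma re_pos_of {l : ℂ} (hl : ‖l‖ = 1) {r : ℝ} (h0 : 0 ≤ r) (h1 : r < 1) :
    0 < (1 - (r : ℂ) * l).re := by
  have := Complex.abs_re_le_norm l
  rw [hl, abs_le] at this
  simp
  nlinarith

lemma exp_LL {n : ℕ} (A : Matrix (Fin n) (Fin n) ℂ) (hA : A ∈ Matrix.unitaryGroup (Fin n) ℂ)
    {r : ℝ} (h0 : 0 ≤ r) (h1 : r < 1) :
    Complex.exp (LL A r) = (1 - (r : ℂ) • A).det := by
  rw [det_one_sub, LL, Complex.exp_multiset_sum, Multiset.map_map]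
  congr 1
  apply Multiset.map_congr rfl
  intro l hl
  have := re_pos_of (norm_root A hA hl) h0 h1
  simp only [Function.comp]
  rw [Complex.exp_log]
  intro h
  rw [h] at this
  simp at this

lemma LL_zero {n : ℕ} (A : Matrix (Fin n) (Fin n) ℂ) : LL A 0 = 0 := by
  simp [LL]

lemma continuousOn_LL {n : ℕ} (A : Matrix (Fin n) (Fin n) ℂ)
    (hA : A ∈ Matrix.unitaryGroup (Fin n) ℂ) : ContinuousOn (LL A) (Set.Ico 0 1) := by
  intro r hr
  apply tendsto_multiset_sum (f := fun l (r : ℝ) => Complex.log (1 - r * l))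
  intro l hl
  have := re_pos_of (norm_root A hA hl) hr.1 hr.2
  have h : ContinuousAt (fun r : ℝ => Complex.log (1 - r * l)) r := by
    apply ContinuousAt.clog
    · fun_prop
    · left; exact this
  exact h.tendsto.mono_left nhdsWithin_le_nhds

lemma tendsto_LL {n : ℕ} (A : Matrix (Fin n) (Fin n) ℂ)
    (hA : A ∈ Matrix.unitaryGroup (Fin n) ℂ) :
    Tendsto (fun r => (LL A r).im) (𝓝[<] 1) (𝓝 (TT A)) := by
  have : ∀ r : ℝ, (LL A r).im = (A.charpoly.roots.map fun l => (Complex.log (1 - r * l)).im).sum := by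
    intro r
    have := map_multiset_sum Complex.imAddGroupHom (A.charpoly.roots.map fun l => Complex.log (1 - r * l))
    rw [Multiset.map_map] at this
    exact this
  simp_rw [this]
  apply tendsto_multiset_sum (f := fun l (r : ℝ) => (Complex.log (1 - r * l)).im)
  intro l hl
  by_cases h1 : l = 1
  · subst h1
    refine (tendsto_const_nhds (x := (0:ℝ))).congr' ?_ |>.trans (by simp)
    filter_upwards [self_mem_nhdsWithin] with r hr
    have hr : r < 1 := hr
    have : (1 - (r:ℂ) * 1) = ((1 - r : ℝ) : ℂ) := by push_cast; ring
    rw [this, Complex.log_im, Complex.arg_ofReal_of_nonneg (by linarith)]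
  · have hre : 0 < (1 - l).re := by
      have hn := norm_root A hA hl
      have h2 := Complex.abs_re_le_norm l
      rw [hn, abs_le] at h2
      have h3 : l.re ≠ 1 := by
        intro h
        apply h1
        have h4 := Complex.sq_norm l
        rw [hn, Complex.normSq_apply, h] at h4
        apply Complex.ext
        · simpa using h
        · simp; nlinarith
      simp
      exact lt_of_le_of_ne h2.2 h3
    have h : ContinuousAt (fun r : ℝ => (Complex.log (1 - r * l)).im) 1 := by
      apply Complex.continuous_im.continuousAt.comp
      apply ContinuousAt.clog
      · fun_prop
      · left; simpa using hre
    have h' := h.tendsto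
    simp only [Complex.ofReal_one, one_mul] at h'
    exact h'.mono_left nhdsWithin_le_nhds

lemma const_of_exp {E : ℝ → ℂ} {s : Set ℝ} (hs : IsPreconnected s) (hE : ContinuousOn E s)
    (h1 : ∀ r ∈ s, Complex.exp (E r) = 1) {a b : ℝ} (ha : a ∈ s) (hb : b ∈ s) : E a = E b := by
  have hd : IsDiscrete (Set.range ((↑) : ℤ → ℝ)) :=
    ⟨(Int.isClosedEmbedding_coe_real.isEmbedding.toHomeomorph.symm.isEmbedding).discreteTopology⟩
  have hk : ∀ r ∈ s, ∃ m : ℤ, E r = m * (2 * π * I) := fun r hr =>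
    Complex.exp_eq_one_iff.1 (h1 r hr)
  have hc : ContinuousOn (fun r => (E r).im / (2 * π)) s :=
    (Complex.continuous_im.comp_continuousOn hE).div_const _
  have hv : ∀ (r : ℝ) (m : ℤ), E r = m * (2 * π * I) → (E r).im / (2 * π) = m := by
    intro r m h
    rw [h]
    simp
  have hm : Set.MapsTo (fun r => (E r).im / (2 * π)) s (Set.range ((↑) : ℤ → ℝ)) := by
    intro r hr
    obtain ⟨m, hm⟩ := hk r hr
    exact ⟨m, (hv r m hm).symm⟩
  have := hs.constant_of_mapsTo hd hc hm ha hb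
  obtain ⟨m, hm⟩ := hk a ha
  obtain ⟨k, hk⟩ := hk b hb
  simp only [hv a m hm, hv b k hk] at this
  have : m = k := by exact_mod_cast this
  rw [hm, hk, this]

end ArgMax

namespace ArgMax
open scoped Topology

/-- The block matrix `1 ⊕ V`. -/
def iota {n : ℕ} (V : Matrix (Fin n) (Fin n) ℂ) : Matrix (Fin (n + 1)) (Fin (n + 1)) ℂ :=
  Matrix.of fun i j => Fin.cases (Fin.cases 1 (fun _ => 0) j) (fun i' => Fin.cases 0 (fun j' => V i' j') j) i

@[simp] lemma iota_zero_zero {n : ℕ} (V : Matrix (Fin n) (Fin n) ℂ) : iota V 0 0 = 1 := rfl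
@[simp] lemma iota_zero_succ {n : ℕ} (V : Matrix (Fin n) (Fin n) ℂ) (j : Fin n) :
    iota V 0 j.succ = 0 := rfl
@[simp] lemma iota_succ_zero {n : ℕ} (V : Matrix (Fin n) (Fin n) ℂ) (j : Fin n) :
    iota V j.succ 0 = 0 := rfl
@[simp] lemma iota_succ_succ {n : ℕ} (V : Matrix (Fin n) (Fin n) ℂ) (i j : Fin n) :
    iota V i.succ j.succ = V i j := rfl

lemma iota_mul {n : ℕ} (V W : Matrix (Fin n) (Fin n) ℂ) : iota (V * W) = iota V * iota W := by
  ext i j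
  refine Fin.cases ?_ (fun i => ?_) i <;> refine Fin.cases ?_ (fun j => ?_) j <;>
    simp [Matrix.mul_apply, Fin.sum_univ_succ]

lemma iota_one {n : ℕ} : iota (1 : Matrix (Fin n) (Fin n) ℂ) = 1 := by
  ext i j
  refine Fin.cases ?_ (fun i => ?_) i <;> refine Fin.cases ?_ (fun j => ?_) j <;>
    simp [Matrix.one_apply, Fin.succ_ne_zero, (Fin.succ_ne_zero _).symm]

lemma iota_star {n : ℕ} (V : Matrix (Fin n) (Fin n) ℂ) : star (iota V) = iota (star V) := by
  ext i j
  refine Fin.cases ?_ (fun i => ?_) i <;> refine Fin.cases ?_ (fun j => ?_) j <;>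
    simp [Matrix.star_apply]

lemma iota_mem {n : ℕ} {V : Matrix (Fin n) (Fin n) ℂ} (hV : V ∈ Matrix.unitaryGroup (Fin n) ℂ) :
    iota V ∈ Matrix.unitaryGroup (Fin (n + 1)) ℂ := by
  rw [Matrix.mem_unitaryGroup_iff] at *
  rw [iota_star, ← iota_mul, hV, iota_one]

lemma det_first_row {n : ℕ} (A : Matrix (Fin (n + 1)) (Fin (n + 1)) ℂ)
    (h : ∀ j : Fin n, A 0 j.succ = 0) :
    A.det = A 0 0 * (Matrix.of fun i j : Fin n => A i.succ j.succ).det := by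
  rw [Matrix.det_succ_row_zero, Fin.sum_univ_succ]
  simp only [h]
  simp
  left
  rfl

lemma det_one_sub_iota {n : ℕ} (V : Matrix (Fin n) (Fin n) ℂ) (z : ℂ) :
    (1 - z • iota V).det = (1 - z) * (1 - z • V).det := by
  rw [det_first_row]
  · congr 1
    · simp
    · congr 1
      ext i j
      simp [Matrix.one_apply]
  · intro j
    simp [Matrix.one_apply, (Fin.succ_ne_zero _).symm]

/-- The complex reflection sending the first basis vector to `e₀ - u`. -/
noncomputable def refl {n : ℕ} (u : Fin (n + 1) → ℂ) : Matrix (Fin (n + 1)) (Fin (n + 1)) ℂ :=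
  1 - (star (u 0))⁻¹ • Matrix.vecMulVec u (star u)

lemma refl_star {n : ℕ} (u : Fin (n + 1) → ℂ) :
    star (refl u) = 1 - (u 0)⁻¹ • Matrix.vecMulVec u (star u) := by
  ext i j
  simp [refl, Matrix.vecMulVec_apply, Matrix.star_apply, Matrix.one_apply, eq_comm, mul_comm]

lemma refl_mem {n : ℕ} {u : Fin (n + 1) → ℂ} (h0 : u 0 ≠ 0)
    (hu : star u ⬝ᵥ u = u 0 + star (u 0)) :
    refl u ∈ Matrix.unitaryGroup (Fin (n + 1)) ℂ := by
  rw [Matrix.mem_unitaryGroup_iff, refl_star, refl]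
  have hs : star (u 0) ≠ 0 := by simpa using h0
  rw [sub_mul, mul_sub, mul_sub, one_mul, one_mul, mul_one, Matrix.smul_mul, Matrix.mul_smul,
    Matrix.vecMulVec_mul_vecMulVec, hu, Matrix.vecMulVec_smul]
  rw [smul_smul, smul_smul]
  have : (star (u 0))⁻¹ * ((u 0)⁻¹ * (u 0 + star (u 0))) = (star (u 0))⁻¹ + (u 0)⁻¹ := by
    field_simp
  have h2 : (star (u 0))⁻¹ * (u 0)⁻¹ * (u 0 + star (u 0)) = (star (u 0))⁻¹ + (u 0)⁻¹ := by
    field_simp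
  simp only [h2, this, add_smul]
  abel

lemma refl_mul {n : ℕ} (u : Fin (n + 1) → ℂ) (M : Matrix (Fin (n + 1)) (Fin (n + 1)) ℂ) :
    refl u * M = M - (star (u 0))⁻¹ • Matrix.vecMulVec u (star u ᵥ* M) := by
  rw [refl, sub_mul, one_mul, Matrix.smul_mul, Matrix.vecMulVec_mul]

/-- a unitary matrix with first column `e₀` is a block matrix. -/
lemma exists_iota {n : ℕ} (A : Matrix (Fin (n + 1)) (Fin (n + 1)) ℂ)
    (hA : A ∈ Matrix.unitaryGroup (Fin (n + 1)) ℂ) (h0 : A 0 0 = 1)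
    (hi : ∀ i : Fin n, A i.succ 0 = 0) :
    ∃ W ∈ Matrix.unitaryGroup (Fin n) ℂ, A = iota W := by
  have hrow : ∀ j : Fin n, A 0 j.succ = 0 := by
    have h1 := congrFun (congrFun (Matrix.mem_unitaryGroup_iff.1 hA) 0) 0
    rw [Matrix.mul_apply, Fin.sum_univ_succ] at h1
    simp only [Matrix.star_apply, h0, Matrix.one_apply_eq, star_one, mul_one] at h1
    have h2 : ∑ j : Fin n, ‖A 0 j.succ‖ ^ 2 = 0 := by
      have h3 : (∑ j : Fin n, A 0 j.succ * star (A 0 j.succ)) = 0 := by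
        linear_combination h1
      have h4 : ((∑ j : Fin n, ‖A 0 j.succ‖ ^ 2 : ℝ) : ℂ) = 0 := by
        rw [← h3]
        push_cast
        apply Finset.sum_congr rfl
        intro j _
        exact (Complex.mul_conj' _).symm
      exact_mod_cast h4
    intro j
    have := (Finset.sum_eq_zero_iff_of_nonneg (fun i _ => by positivity)).1 h2 j (Finset.mem_univ _)
    simpa using this
  refine ⟨Matrix.of fun i j : Fin n => A i.succ j.succ, ?_, ?_⟩
  · rw [Matrix.mem_unitaryGroup_iff]
    ext i j
    have h1 := congrFun (congrFun (Matrix.mem_unitaryGroup_iff.1 hA) i.succ) j.succ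
    rw [Matrix.mul_apply, Fin.sum_univ_succ] at h1
    simp only [Matrix.star_apply, hi, zero_mul, zero_add] at h1
    rw [Matrix.mul_apply]
    simp only [Matrix.star_apply, Matrix.of_apply]
    rw [h1]
    simp [Matrix.one_apply]
  · ext i j
    refine Fin.cases ?_ (fun i => ?_) i <;> refine Fin.cases ?_ (fun j => ?_) j <;>
      simp [h0, hi, hrow]

/-- Householder decomposition. -/
lemma exists_decomp {n : ℕ} (A : Matrix (Fin (n + 1)) (Fin (n + 1)) ℂ)
    (hA : A ∈ Matrix.unitaryGroup (Fin (n + 1)) ℂ) (h0 : A 0 0 ≠ 1) :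
    ∃ u : Fin (n + 1) → ℂ, u 0 = 1 - A 0 0 ∧ star u ⬝ᵥ u = u 0 + star (u 0) ∧
      ∃ W ∈ Matrix.unitaryGroup (Fin n) ℂ, A = refl u * iota W := by
  set u : Fin (n + 1) → ℂ := fun i => (1 : Matrix (Fin (n + 1)) (Fin (n + 1)) ℂ) i 0 - A i 0 with hu
  have hu0 : u 0 = 1 - A 0 0 := by simp [hu]
  have hu0' : u 0 ≠ 0 := by rw [hu0]; exact sub_ne_zero.2 h0.symm
  have hs : star (u 0) ≠ 0 := by simpa using hu0'
  have hsum : ∑ i, star (A i 0) * A i 0 = 1 := by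
    have h1 := congrFun (congrFun (Matrix.mem_unitaryGroup_iff'.1 hA) 0) 0
    rw [Matrix.mul_apply] at h1
    simpa [Matrix.star_apply] using h1
  have huu : star u ⬝ᵥ u = u 0 + star (u 0) := by
    rw [dotProduct]
    have : ∀ i, (star u) i * u i = (1 : Matrix (Fin (n + 1)) (Fin (n + 1)) ℂ) i 0
        - (1 : Matrix (Fin (n + 1)) (Fin (n + 1)) ℂ) i 0 * A i 0
        - (1 : Matrix (Fin (n + 1)) (Fin (n + 1)) ℂ) i 0 * star (A i 0) + star (A i 0) * A i 0 := by
      intro i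
      by_cases hi : i = 0
      · subst hi
        simp [hu]
        ring
      · simp [hu, Matrix.one_apply, hi]
    simp_rw [this]
    rw [Finset.sum_add_distrib, Finset.sum_sub_distrib, Finset.sum_sub_distrib, hsum]
    simp [Matrix.one_apply, hu0]
    ring
  refine ⟨u, hu0, huu, ?_⟩
  have hR := refl_mem hu0' huu
  have hRA : star (refl u) * A ∈ Matrix.unitaryGroup (Fin (n + 1)) ℂ :=
    mul_mem (Unitary.star_mem hR) hA
  have hcol : ∀ i, (star (refl u) * A) i 0 = (1 : Matrix (Fin (n + 1)) (Fin (n + 1)) ℂ) i 0 := by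
    intro i
    have hv : (star u ᵥ* A) 0 = - u 0 := by
      have : (star u ᵥ* A) 0 = ∑ i, ((1 : Matrix (Fin (n + 1)) (Fin (n + 1)) ℂ) i 0 * A i 0 -
          star (A i 0) * A i 0) := by
        simp only [Matrix.vecMul, dotProduct]
        apply Finset.sum_congr rfl
        intro i _
        by_cases hi : i = 0
        · subst hi
          simp [hu]
          ring
        · simp [hu, Matrix.one_apply, hi]
      rw [this, Finset.sum_sub_distrib, hsum]
      simp [Matrix.one_apply, hu0]
    rw [refl_star, sub_mul, one_mul, Matrix.smul_mul, Matrix.vecMulVec_mul, Matrix.sub_apply,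
      Matrix.smul_apply, Matrix.vecMulVec_apply, hv]
    simp only [smul_eq_mul]
    have : (u 0)⁻¹ * (u i * -u 0) = - u i := by field_simp
    rw [this]
    simp [hu]
  obtain ⟨W, hW, hAW⟩ := exists_iota _ hRA (by rw [hcol]; simp)
    (fun i => by rw [hcol]; simp [Matrix.one_apply])
  refine ⟨W, hW, ?_⟩
  rw [← hAW, ← mul_assoc, (Matrix.mem_unitaryGroup_iff.1 hR), one_mul]

end ArgMax

namespace ArgMax
open scoped Topology

/-- squared norm -/
noncomputable def nsq {m : ℕ} (u : Fin m → ℂ) : ℝ := ∑ i, ‖u i‖ ^ 2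

lemma star_dot {m : ℕ} (u : Fin m → ℂ) : star u ⬝ᵥ u = (nsq u : ℂ) := by
  rw [nsq, dotProduct]
  push_cast
  apply Finset.sum_congr rfl
  intro j _
  simp [← Complex.conj_mul']

lemma nsq_pos {m : ℕ} {u : Fin m → ℂ} (hu : u ≠ 0) : 0 < nsq u := by
  obtain ⟨i, hi⟩ := Function.ne_iff.1 hu
  have : 0 < ‖u i‖ ^ 2 := by
    have : 0 < ‖u i‖ := norm_pos_iff.2 hi
    positivity
  exact lt_of_lt_of_le this
    (Finset.single_le_sum (f := fun i => ‖u i‖ ^ 2) (fun i _ => by positivity) (Finset.mem_univ i))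

lemma re_u0_pos {n : ℕ} {u : Fin (n + 1) → ℂ} (h0 : u 0 ≠ 0)
    (hu : star u ⬝ᵥ u = u 0 + star (u 0)) : nsq u = 2 * (u 0).re ∧ 0 < (u 0).re := by
  have h1 : nsq u = 2 * (u 0).re := by
    rw [star_dot] at hu
    have := congrArg Complex.re hu
    simp at this
    linarith
  have h2 : 0 < nsq u := nsq_pos (fun h => h0 (by rw [h]; rfl))
  exact ⟨h1, by linarith⟩

lemma slit_mul {p q : ℂ} (hp : 0 < p.re) (hq : 0 < q.re) : p * q ∈ Complex.slitPlane := by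
  rw [Complex.mem_slitPlane_iff]
  by_contra! h
  obtain ⟨h1, h2⟩ := h
  simp at h1 h2
  have h3 : p.re * (p.re * q.re - p.im * q.im) ≤ 0 := mul_nonpos_of_nonneg_of_nonpos hp.le (by linarith)
  have h4 : p.re * q.im = - (p.im * q.re) := by linarith
  have h5 : p.re * (p.re * q.re - p.im * q.im) = p.re^2 * q.re + p.im ^ 2 * q.re := by
    linear_combination (-p.im) * h4
  have h6 : 0 < p.re ^ 2 * q.re := by positivity
  have h7 : 0 ≤ p.im ^ 2 * q.re := by positivity
  linarith

lemma det_ne_zero_of_lt {n : ℕ} (A : Matrix (Fin n) (Fin n) ℂ)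
    (hA : A ∈ Matrix.unitaryGroup (Fin n) ℂ) {r : ℝ} (h0 : 0 ≤ r) (h1 : r < 1) :
    (1 - (r : ℂ) • A).det ≠ 0 := by
  rw [← exp_LL A hA h0 h1]
  exact Complex.exp_ne_zero _

/-- ratio of determinants stays in the slit plane -/
lemma ratio_slit {n : ℕ} {u : Fin (n + 1) → ℂ} (h0 : u 0 ≠ 0)
    (hu : star u ⬝ᵥ u = u 0 + star (u 0)) (M : Matrix (Fin (n + 1)) (Fin (n + 1)) ℂ)
    (hM : M ∈ Matrix.unitaryGroup (Fin (n + 1)) ℂ) {r : ℝ} (hr0 : 0 ≤ r) (hr1 : r < 1) :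
    (1 - (r : ℂ) • (refl u * M)).det / (1 - (r : ℂ) • M).det ∈ Complex.slitPlane := by
  obtain ⟨hn, hre⟩ := re_u0_pos h0 hu
  set A := 1 - (r : ℂ) • M with hAdef
  have hA : A.det ≠ 0 := det_ne_zero_of_lt M hM hr0 hr1
  have hAu : IsUnit A.det := isUnit_iff_ne_zero.2 hA
  have hs : star (u 0) ≠ 0 := by simpa using h0
  set κ := (star (u 0))⁻¹ with hκ
  have e1 : 1 - (r : ℂ) • (refl u * M) =
      A + Matrix.replicateCol Unit u * Matrix.replicateRow Unit ((r * κ) • (star u ᵥ* M)) := by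
    rw [refl_mul]
    ext i j
    simp only [hAdef, Matrix.vecMulVec_apply, Matrix.mul_apply, Matrix.sub_apply, Matrix.add_apply,
      Matrix.smul_apply, smul_eq_mul, Matrix.replicateCol_apply, Matrix.replicateRow_apply,
      Pi.smul_apply, Finset.univ_unique, Finset.sum_singleton, ← hκ]
    ring
  rw [e1, Matrix.det_add_replicateCol_mul_replicateRow hAu, mul_div_assoc, mul_comm, div_mul_cancel₀ _ hA]
  set y := A⁻¹ *ᵥ u with hy
  have hAy : A *ᵥ y = u := by
    rw [hy, Matrix.mulVec_mulVec, Matrix.mul_nonsing_inv _ hAu, Matrix.one_mulVec]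
  set z := M *ᵥ y with hz
  have huyz : u = y - (r : ℂ) • z := by
    rw [← hAy, hAdef, Matrix.sub_mulVec, Matrix.one_mulVec, Matrix.smul_mulVec]
  have hzz : star z ⬝ᵥ z = star y ⬝ᵥ y := by
    rw [hz, Matrix.star_mulVec, Matrix.dotProduct_mulVec, Matrix.vecMul_vecMul,
      ← Matrix.star_eq_conjTranspose, Matrix.mem_unitaryGroup_iff'.1 hM, Matrix.vecMul_one]
  have hf : (1 + Matrix.replicateRow Unit ((r * κ) • (star u ᵥ* M)) * A⁻¹ *
      Matrix.replicateCol Unit u).det = 1 + r * κ * (star u ⬝ᵥ z) := by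
    rw [Matrix.det_unique, Matrix.mul_assoc]
    have : A⁻¹ * Matrix.replicateCol Unit u = Matrix.replicateCol Unit y := by
      ext i j
      simp [hy, Matrix.mul_apply, Matrix.mulVec, dotProduct]
    rw [this]
    simp only [Matrix.add_apply, Matrix.one_apply_eq, Matrix.replicateRow_mul_replicateCol_apply]
    rw [smul_dotProduct, ← Matrix.dotProduct_mulVec, smul_eq_mul]
  rw [hf]
  have hyne : y ≠ 0 := by
    intro h
    rw [h, Matrix.mulVec_zero] at hAy
    exact h0 (by rw [← hAy]; rfl)
  have hypos := nsq_pos hyne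
  have huz : star u ⬝ᵥ z = star y ⬝ᵥ z - r * nsq y := by
    rw [huyz, star_sub, sub_dotProduct, star_smul, smul_dotProduct, hzz, star_dot]
    simp
  have hzy : star z ⬝ᵥ y = star (star y ⬝ᵥ z) := by
    rw [Matrix.star_dotProduct]
  have hnu : (nsq u : ℂ) = nsq y - r * (star y ⬝ᵥ z) - r * star (star y ⬝ᵥ z) + r ^ 2 * nsq y := by
    rw [← star_dot u]
    conv_lhs => rw [huyz]
    rw [star_sub, sub_dotProduct, dotProduct_sub, dotProduct_sub, star_smul, smul_dotProduct,
      smul_dotProduct, dotProduct_smul, dotProduct_smul, hzz, hzy, star_dot]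
    simp
    ring
  have hp : 0 < (star (u 0) + r * (star u ⬝ᵥ z)).re := by
    rw [huz]
    have h3 := congrArg Complex.re hnu
    simp [pow_two] at h3
    simp
    rw [hn] at h3
    have : 0 < nsq y * (1 - r ^ 2) := by
      apply mul_pos hypos
      nlinarith
    nlinarith
  have hfin : 1 + r * κ * (star u ⬝ᵥ z) =
      ((star (u 0) + r * (star u ⬝ᵥ z)) * ((‖u 0‖ ^ 2 : ℝ)⁻¹ : ℝ)) * u 0 := by
    have hn2 : star (u 0) * u 0 = ((‖u 0‖ ^ 2 : ℝ) : ℂ) := by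
      simp [← Complex.conj_mul']
    rw [Complex.ofReal_inv, ← hn2, hκ]
    field_simp
  rw [hfin]
  apply slit_mul _ hre
  rw [Complex.re_mul_ofReal]
  have : 0 < ‖u 0‖ := norm_pos_iff.2 h0
  positivity

/-- the determinant at `r = 1` -/
lemma det_refl {n : ℕ} {u : Fin (n + 1) → ℂ} (h0 : u 0 ≠ 0)
    (V : Matrix (Fin n) (Fin n) ℂ) :
    (1 - (refl u * iota V)).det = u 0 * (1 - V).det := by
  set B : Matrix (Fin (n + 1)) (Fin (n + 1)) ℂ := Matrix.of fun i j =>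
    Fin.cases (u i) (fun j' => (1 - iota V) i j'.succ) j with hB
  have hs : star (u 0) ≠ 0 := by simpa using h0
  have h1 : (1 - (refl u * iota V)).det = B.det := by
    rw [← Matrix.det_transpose, ← Matrix.det_transpose B]
    apply Matrix.det_eq_of_forall_row_eq_smul_add_const
      (fun j => Fin.cases 0 (fun j' => (star (u 0))⁻¹ * (star u ᵥ* iota V) j'.succ) j) 0 rfl
    intro j i
    rw [Matrix.transpose_apply, Matrix.transpose_apply, Matrix.transpose_apply, refl_mul]
    refine Fin.cases ?_ (fun j => ?_) j
    · have : (star u ᵥ* iota V) 0 = star (u 0) := by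
        simp [Matrix.vecMul, dotProduct, Fin.sum_univ_succ]
      simp only [Matrix.sub_apply, Matrix.smul_apply, Matrix.vecMulVec_apply, this, hB, smul_eq_mul,
        Matrix.of_apply, Fin.cases_zero]
      have h2 : iota V i 0 = (1 : Matrix (Fin (n + 1)) (Fin (n + 1)) ℂ) i 0 := by
        refine Fin.cases ?_ (fun i => ?_) i <;> simp [Matrix.one_apply]
      rw [h2]
      field_simp
      ring
    · simp only [Matrix.sub_apply, Matrix.smul_apply, Matrix.vecMulVec_apply, hB, smul_eq_mul,
        Matrix.of_apply, Fin.cases_zero, Fin.cases_succ]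
      ring
  rw [h1, det_first_row]
  · congr 1
    congr 1
    ext i j
    simp [hB, Matrix.one_apply]
  · intro j
    simp [hB, Matrix.one_apply, (Fin.succ_ne_zero _).symm]

lemma continuous_det {n : ℕ} (A : Matrix (Fin n) (Fin n) ℂ) :
    Continuous fun r : ℝ => (1 - (r : ℂ) • A).det := by
  apply Continuous.matrix_det
  fun_prop

lemma key {n : ℕ} {u : Fin (n + 1) → ℂ} (h0 : u 0 ≠ 0)
    (hu : star u ⬝ᵥ u = u 0 + star (u 0)) (V : Matrix (Fin n) (Fin n) ℂ)
    (hV : V ∈ Matrix.unitaryGroup (Fin n) ℂ) (hdet : (1 - V).det ≠ 0) :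
    TT (refl u * iota V) = TT V + Complex.arg (u 0) := by
  obtain ⟨hn, hre⟩ := re_u0_pos h0 hu
  set U := refl u * iota V with hU
  have hUm : U ∈ Matrix.unitaryGroup (Fin (n + 1)) ℂ := mul_mem (refl_mem h0 hu) (iota_mem hV)
  set f : ℝ → ℂ := fun r => (1 - (r : ℂ) • U).det / (1 - (r : ℂ) • iota V).det with hf
  have hfs : ∀ r ∈ Set.Ico (0:ℝ) 1, f r ∈ Complex.slitPlane := fun r hr =>
    ratio_slit h0 hu (iota V) (iota_mem hV) hr.1 hr.2
  have hfc : ContinuousOn f (Set.Ico 0 1) := by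
    apply ContinuousOn.div (continuous_det U).continuousOn (continuous_det _).continuousOn
    intro r hr
    exact det_ne_zero_of_lt _ (iota_mem hV) hr.1 hr.2
  set E : ℝ → ℂ := fun r => LL U r - LL V r - Complex.log (f r) - Complex.log ((1 - r : ℝ) : ℂ) with hE
  have hEc : ContinuousOn E (Set.Ico 0 1) := by
    refine (((continuousOn_LL U hUm).sub (continuousOn_LL V hV)).sub (hfc.clog hfs)).sub ?_
    apply ContinuousOn.clog
    · fun_prop
    · intro r hr
      left
      have := hr.2
      rw [Complex.ofReal_re]
      linarith
  have hE1 : ∀ r ∈ Set.Ico (0:ℝ) 1, Complex.exp (E r) = 1 := by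
    intro r hr
    have hr1 : (1 - r : ℝ) ≠ 0 := by have := hr.2; intro h; linarith
    have hr1' : (1 - (r:ℂ)) ≠ 0 := by exact_mod_cast hr1
    have hVd := det_ne_zero_of_lt V hV hr.1 hr.2
    have hUd := det_ne_zero_of_lt U hUm hr.1 hr.2
    simp only [hE]
    rw [Complex.exp_sub, Complex.exp_sub, Complex.exp_sub, exp_LL U hUm hr.1 hr.2,
      exp_LL V hV hr.1 hr.2, Complex.exp_log (Complex.slitPlane_ne_zero (hfs r hr)),
      Complex.exp_log (by exact_mod_cast hr1), hf]
    simp only [det_one_sub_iota]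
    push_cast
    field_simp
  have hE0 : ∀ r ∈ Set.Ico (0:ℝ) 1, E r = 0 := by
    intro r hr
    rw [const_of_exp isPreconnected_Ico hEc hE1 hr (Set.left_mem_Ico.2 one_pos)]
    simp [hE, LL_zero, hf]
  have hlim : Tendsto (fun r => (LL V r).im + Complex.arg ((1 - (r : ℂ) • U).det / (1 - (r : ℂ) • V).det))
      (𝓝[<] 1) (𝓝 (TT V + Complex.arg (u 0))) := by
    apply (tendsto_LL V hV).add
    have hc : ContinuousAt (fun r : ℝ => (1 - (r : ℂ) • U).det / (1 - (r : ℂ) • V).det) 1 := by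
      apply ContinuousAt.div (continuous_det U).continuousAt (continuous_det V).continuousAt
      simpa using hdet
    have hv : (1 - ((1:ℝ) : ℂ) • U).det / (1 - ((1:ℝ) : ℂ) • V).det = u 0 := by
      simp only [Complex.ofReal_one, one_smul]
      rw [hU, det_refl h0, mul_div_assoc, div_self hdet, mul_one]
    have hc2 : ContinuousAt (fun r : ℝ => Complex.arg ((1 - (r : ℂ) • U).det / (1 - (r : ℂ) • V).det)) 1 := by
      apply ContinuousAt.comp (g := Complex.arg) _ hc
      apply Complex.continuousAt_arg
      rw [hv]
      left; exact hre
    have := hc2.tendsto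
    rw [hv] at this
    exact this.mono_left nhdsWithin_le_nhds
  refine tendsto_nhds_unique (tendsto_LL U hUm) (hlim.congr' ?_)
  have : Set.Ioo (0:ℝ) 1 ∈ 𝓝[<] (1:ℝ) := Ioo_mem_nhdsLT one_pos
  filter_upwards [this] with r hr
  have hr' : r ∈ Set.Ico (0:ℝ) 1 := ⟨hr.1.le, hr.2⟩
  have h1 := congrArg Complex.im (hE0 r hr')
  have hr1 : 0 < (1 - r : ℝ) := by linarith [hr.2]
  have hr1' : (1 - (r:ℂ)) ≠ 0 := by exact_mod_cast hr1.ne'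
  simp only [hE, Complex.sub_im, Complex.log_im, Complex.zero_im] at h1
  rw [Complex.arg_ofReal_of_nonneg hr1.le] at h1
  have h2 : (1 - (r : ℂ) • U).det / (1 - (r : ℂ) • V).det = ((1 - r : ℝ) : ℂ) * f r := by
    simp only [hf, det_one_sub_iota]
    push_cast
    field_simp
  rw [h2, Complex.arg_real_mul _ hr1]
  linarith

end ArgMax

namespace ArgMax
open scoped Topology

instance instSecond (n : ℕ) : SecondCountableTopology (Matrix.unitaryGroup (Fin n) ℂ) := by
  have : SecondCountableTopology (Matrix (Fin n) (Fin n) ℂ) :=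
    inferInstanceAs (SecondCountableTopology (Fin n → Fin n → ℂ))
  exact TopologicalSpace.Subtype.secondCountableTopology _

instance instCompact (n : ℕ) : CompactSpace (Matrix.unitaryGroup (Fin n) ℂ) := by
  apply isCompact_iff_compactSpace.1
  have hc : IsCompact (Set.pi Set.univ fun _ : Fin n => Set.pi Set.univ fun _ : Fin n =>
      Metric.closedBall (0:ℂ) 1) :=
    isCompact_univ_pi fun _ => isCompact_univ_pi fun _ => isCompact_closedBall _ _
  apply IsCompact.of_isClosed_subset (X := Matrix (Fin n) (Fin n) ℂ) hc
  · have : (Matrix.unitaryGroup (Fin n) ℂ : Set (Matrix (Fin n) (Fin n) ℂ)) =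
        {A | A * star A = 1} := by
      ext A
      simp [Matrix.mem_unitaryGroup_iff]
    rw [this]
    apply isClosed_eq
    · fun_prop
    · fun_prop
  · intro A hA i _ j _
    exact mem_closedBall_zero_iff.2 (entry_norm_bound_of_unitary hA i j)

instance instRight (n : ℕ) (μ : Measure (Matrix.unitaryGroup (Fin n) ℂ)) [μ.IsHaarMeasure]
    [IsProbabilityMeasure μ] : μ.IsMulRightInvariant := by
  constructor
  intro g
  have : IsProbabilityMeasure (Measure.map (fun x => x * g) μ) :=
    Measure.isProbabilityMeasure_map (by fun_prop)
  exact Measure.isHaarMeasure_eq_of_isProbabilityMeasure _ _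

lemma continuous_det_right {n : ℕ} (z : ℂ) :
    Continuous fun A : Matrix.unitaryGroup (Fin n) ℂ =>
      (1 - z • (A : Matrix (Fin n) (Fin n) ℂ)).det := by
  apply Continuous.matrix_det
  fun_prop

lemma tendsto_tele {n : ℕ} (A : Matrix (Fin n) (Fin n) ℂ)
    (hA : A ∈ Matrix.unitaryGroup (Fin n) ℂ) {s : ℝ} (hs0 : 0 ≤ s) (hs1 : s < 1) :
    Tendsto (fun N : ℕ => ∑ j ∈ Finset.range N,
      (Complex.log ((1 - ((s * ((j + 1 : ℕ) / N) : ℝ) : ℂ) • A).det /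
        (1 - ((s * ((j : ℕ) / N) : ℝ) : ℂ) • A).det)).im) atTop (𝓝 (LL A s).im) := by
  have hc : ContinuousOn (LL A) (Set.Icc 0 s) :=
    (continuousOn_LL A hA).mono fun x hx => ⟨hx.1, lt_of_le_of_lt hx.2 hs1⟩
  have hu := isCompact_Icc.uniformContinuousOn_of_continuous hc
  rw [Metric.uniformContinuousOn_iff] at hu
  obtain ⟨δ, hδ, h⟩ := hu 1 one_pos
  apply tendsto_const_nhds.congr'
  obtain ⟨K, hK⟩ := exists_nat_gt (1 / δ)
  filter_upwards [eventually_ge_atTop (K + 1)] with N hN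
  have hN0 : (0:ℝ) < N := by
    have : 0 < N := by omega
    exact_mod_cast this
  have hNK : 1 / δ < N := by
    have : (K:ℝ) + 1 ≤ N := by exact_mod_cast hN
    linarith
  have hmem : ∀ j : ℕ, j ≤ N → s * (j / N) ∈ Set.Icc 0 s := by
    intro j hj
    have hj' : (j:ℝ) ≤ N := by exact_mod_cast hj
    have h1 : (j:ℝ) / N ≤ 1 := (div_le_one hN0).2 hj'
    have h2 : (0:ℝ) ≤ j / N := by positivity
    exact ⟨by positivity, by nlinarith⟩
  have hterm : ∀ j ∈ Finset.range N, (Complex.log ((1 - ((s * ((j + 1 : ℕ) / N) : ℝ) : ℂ) • A).det /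
        (1 - ((s * ((j : ℕ) / N) : ℝ) : ℂ) • A).det)).im =
        (LL A (s * ((j + 1 : ℕ) / N))).im - (LL A (s * ((j : ℕ) / N))).im := by
    intro j hj
    have hjN := Finset.mem_range.1 hj
    have m1 := hmem j hjN.le
    have m2 := hmem (j + 1) hjN
    rw [← exp_LL A hA m1.1 (m1.2.trans_lt hs1), ← exp_LL A hA m2.1 (m2.2.trans_lt hs1),
      ← Complex.exp_sub]
    have hd := h _ m2 _ m1 (by
      rw [Real.dist_eq]
      have : s * (((j + 1 : ℕ) : ℝ) / N) - s * (j / N) = s / N := by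
        push_cast; field_simp; ring
      rw [this, abs_of_nonneg (by positivity)]
      rw [div_lt_iff₀ hN0]
      rw [div_lt_iff₀ hδ] at hNK
      linarith)
    rw [dist_eq_norm] at hd
    have him := (Complex.abs_im_le_norm (LL A (s * ((j + 1 : ℕ) / N)) - LL A (s * ((j : ℕ) / N)))).trans_lt hd
    rw [abs_lt] at him
    have hpi := Real.pi_gt_three
    rw [Complex.log_exp (by linarith) (by linarith), Complex.sub_im]
  rw [Finset.sum_congr rfl hterm, Finset.sum_range_sub (fun j : ℕ => (LL A (s * ((j : ℕ) / N))).im)]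
  simp [LL_zero, hN0.ne']

lemma measurable_LL {n : ℕ} {s : ℝ} (hs0 : 0 ≤ s) (hs1 : s < 1) :
    Measurable fun A : Matrix.unitaryGroup (Fin n) ℂ => (LL (A : Matrix (Fin n) (Fin n) ℂ) s).im := by
  apply measurable_of_tendsto_metrizable (f := fun (N : ℕ) (A : Matrix.unitaryGroup (Fin n) ℂ) =>
    ∑ j ∈ Finset.range N,
      (Complex.log ((1 - ((s * ((j + 1 : ℕ) / N) : ℝ) : ℂ) • (A : Matrix (Fin n) (Fin n) ℂ)).det /
        (1 - ((s * ((j : ℕ) / N) : ℝ) : ℂ) • (A : Matrix (Fin n) (Fin n) ℂ)).det)).im)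
  · intro N
    apply Finset.measurable_sum
    intro j _
    apply Complex.measurable_im.comp
    apply Complex.measurable_log.comp
    exact (continuous_det_right _).measurable.div (continuous_det_right _).measurable
  · rw [tendsto_pi_nhds]
    intro A
    exact tendsto_tele _ A.2 hs0 hs1

lemma measurable_TT {n : ℕ} :
    Measurable fun A : Matrix.unitaryGroup (Fin n) ℂ => TT (A : Matrix (Fin n) (Fin n) ℂ) := by
  apply measurable_of_tendsto_metrizable (f := fun (k : ℕ) (A : Matrix.unitaryGroup (Fin n) ℂ) =>
    (LL (A : Matrix (Fin n) (Fin n) ℂ) (1 - 1 / ((k:ℝ) + 1))).im)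
  · intro k
    apply measurable_LL
    · have : 1 / ((k:ℝ) + 1) ≤ 1 := by
        rw [div_le_one (by positivity)]
        linarith [(Nat.cast_nonneg k : (0:ℝ) ≤ k)]
      linarith
    · have : 0 < 1 / ((k:ℝ) + 1) := by positivity
      linarith
  · rw [tendsto_pi_nhds]
    intro A
    refine (tendsto_LL _ A.2).comp ?_
    rw [tendsto_nhdsWithin_iff]
    constructor
    · simpa using (tendsto_const_nhds (x := (1:ℝ))).sub (tendsto_one_div_add_atTop_nhds_zero_nat (𝕜 := ℝ))
    · filter_upwards with k
      have : 0 < 1 / ((k:ℝ) + 1) := by positivity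
      simp only [Set.mem_Iio]
      linarith

/-- scalar unitary -/
noncomputable def scal (n : ℕ) (c : ℂ) (hc : ‖c‖ = 1) : Matrix.unitaryGroup (Fin n) ℂ :=
  ⟨c • 1, by
    rw [Matrix.mem_unitaryGroup_iff, star_smul, star_one, Matrix.smul_mul, one_mul, smul_smul]
    have : c * star c = 1 := by
      have := Complex.mul_conj' c
      rw [hc] at this
      simpa using this
    rw [this, one_smul]⟩

lemma scal_mul {n : ℕ} (c : ℂ) (hc : ‖c‖ = 1) (A : Matrix.unitaryGroup (Fin n) ℂ) :
    ((scal n c hc * A : Matrix.unitaryGroup (Fin n) ℂ) : Matrix (Fin n) (Fin n) ℂ) =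
      c • (A : Matrix (Fin n) (Fin n) ℂ) := by
  simp [scal]

section meas
variable {n : ℕ} (μ : Measure (Matrix.unitaryGroup (Fin n) ℂ)) [μ.IsHaarMeasure]
    [IsProbabilityMeasure μ]

lemma null_det : ∀ᵐ A : Matrix.unitaryGroup (Fin n) ℂ ∂μ, (1 - (A : Matrix (Fin n) (Fin n) ℂ)).det ≠ 0 := by
  classical
  set S : ℂ → Set (Matrix.unitaryGroup (Fin n) ℂ) := fun c =>
    {A | (1 - c • (A : Matrix (Fin n) (Fin n) ℂ)).det = 0} with hS
  have hSm : ∀ c, MeasurableSet (S c) := fun c =>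
    (isClosed_singleton.preimage (continuous_det_right c)).measurableSet
  have hinv : ∀ c, ‖c‖ = 1 → μ (S c) = μ (S 1) := by
    intro c hc
    have : S c = (fun A => scal n c hc * A) ⁻¹' (S 1) := by
      ext A
      simp only [hS, Set.mem_ofPred_eq, Set.mem_preimage, scal_mul, one_smul]
    rw [this, measure_preimage_mul]
  set f : ℕ → ℂ := fun k => Complex.exp ((1 / ((k:ℝ) + 1) : ℝ) * I) with hf
  have hfn : ∀ k, ‖f k‖ = 1 := fun k => Complex.norm_exp_ofReal_mul_I _
  have hfi : Function.Injective f := by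
    intro k l hkl
    have hb : ∀ k : ℕ, 0 < 1 / ((k:ℝ) + 1) ∧ 1 / ((k:ℝ) + 1) ≤ 1 := by
      intro k
      refine ⟨by positivity, ?_⟩
      rw [div_le_one (by positivity)]
      linarith [(Nat.cast_nonneg k : (0:ℝ) ≤ k)]
    have hpi := Real.pi_gt_three
    have := congrArg Complex.arg hkl
    simp only [hf] at this
    rw [Complex.arg_exp_mul_I, Complex.arg_exp_mul_I,
      (toIocMod_eq_self _).2 ⟨by linarith [hb k], by linarith [hb k]⟩,
      (toIocMod_eq_self _).2 ⟨by linarith [hb l], by linarith [hb l]⟩] at this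
    have h2 : (k:ℝ) + 1 = l + 1 := by
      field_simp at this
      linarith
    have h3 : (k:ℝ) = l := by linarith
    exact_mod_cast h3
  have hcount : ∀ (N : ℕ) (A : Matrix.unitaryGroup (Fin n) ℂ),
      ∑ k ∈ Finset.range N, (S (f k)).indicator (1 : Matrix.unitaryGroup (Fin n) ℂ → ENNReal) A ≤ n := by
    intro N A
    have h1 : ∑ k ∈ Finset.range N, (S (f k)).indicator (1 : Matrix.unitaryGroup (Fin n) ℂ → ENNReal) A =
        (((Finset.range N).filter fun k => A ∈ S (f k)).card : ENNReal) := by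
      simp [Set.indicator_apply]
    rw [h1]
    have h2 : ((Finset.range N).filter fun k => A ∈ S (f k)).card ≤
        (A : Matrix (Fin n) (Fin n) ℂ).charpoly.roots.toFinset.card := by
      apply Finset.card_le_card_of_injOn (fun k => (f k)⁻¹)
      · intro k hk
        have hk2 : A ∈ S (f k) := (Finset.mem_filter.1 hk).2
        simp only [hS, Set.mem_ofPred_eq, det_one_sub] at hk2
        rw [Multiset.prod_eq_zero_iff, Multiset.mem_map] at hk2
        obtain ⟨l, hl, hl2⟩ := hk2
        have : (f k)⁻¹ = l := by
          rw [inv_eq_iff_eq_inv]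
          exact eq_inv_of_mul_eq_one_left (by linear_combination -hl2)
        simp only [this]
        exact Multiset.mem_toFinset.2 hl
      · intro k _ l _ hkl
        exact hfi (inv_injective hkl)
    have h3 := Multiset.toFinset_card_le (A : Matrix (Fin n) (Fin n) ℂ).charpoly.roots
    rw [card_roots] at h3
    exact_mod_cast h2.trans h3
  have hN : ∀ N : ℕ, (N : ENNReal) * μ (S 1) ≤ n := by
    intro N
    calc (N : ENNReal) * μ (S 1) = ∑ k ∈ Finset.range N, μ (S (f k)) := by
          simp [hinv _ (hfn _)]
      _ = ∑ k ∈ Finset.range N, ∫⁻ A, (S (f k)).indicator (1 : Matrix.unitaryGroup (Fin n) ℂ → ENNReal) A ∂μ := by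
          apply Finset.sum_congr rfl
          intro k _
          rw [lintegral_indicator_one (hSm _)]
      _ = ∫⁻ A, ∑ k ∈ Finset.range N, (S (f k)).indicator (1 : Matrix.unitaryGroup (Fin n) ℂ → ENNReal) A ∂μ := by
          rw [lintegral_finsetSum]
          intro k _
          exact measurable_one.indicator (hSm _)
      _ ≤ ∫⁻ A, n ∂μ := lintegral_mono (hcount N)
      _ = n := by simp
  have hzero : μ (S 1) = 0 := by
    by_contra hne
    have h1 : ENNReal.ofReal ((μ (S 1)).toReal) = μ (S 1) := ENNReal.ofReal_toReal (measure_ne_top _ _)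
    have hpos : 0 < (μ (S 1)).toReal := ENNReal.toReal_pos hne (measure_ne_top _ _)
    obtain ⟨N, hN'⟩ := exists_nat_gt ((n:ℝ) / (μ (S 1)).toReal)
    have h2 := ENNReal.toReal_mono (by simp) (hN N)
    rw [ENNReal.toReal_mul] at h2
    simp at h2
    rw [div_lt_iff₀ hpos] at hN'
    linarith
  rw [ae_iff]
  convert hzero using 2
  ext A
  simp [hS]

end meas

lemma null_entry {n : ℕ} (μ : Measure (Matrix.unitaryGroup (Fin (n + 1)) ℂ)) [μ.IsHaarMeasure]
    [IsProbabilityMeasure μ] : ∀ᵐ A : Matrix.unitaryGroup (Fin (n + 1)) ℂ ∂μ, (A : Matrix (Fin (n + 1)) (Fin (n + 1)) ℂ) 0 0 ≠ 1 := by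
  filter_upwards [null_det μ] with A hA h
  apply hA
  apply Matrix.det_eq_zero_of_column_eq_zero 0
  have h1 := congrFun (congrFun (Matrix.mem_unitaryGroup_iff'.1 A.2) 0) 0
  rw [Matrix.mul_apply, Fin.sum_univ_succ] at h1
  simp only [Matrix.star_apply, h, Matrix.one_apply_eq, star_one, mul_one] at h1
  have h2 : ∑ j : Fin n, ‖(A : Matrix (Fin (n + 1)) (Fin (n + 1)) ℂ) j.succ 0‖ ^ 2 = 0 := by
    have h4 : ((∑ j : Fin n, ‖(A : Matrix (Fin (n + 1)) (Fin (n + 1)) ℂ) j.succ 0‖ ^ 2 : ℝ) : ℂ) = 0 := by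
      push_cast
      have h5 : ∀ j : Fin n, ((‖(A : Matrix (Fin (n + 1)) (Fin (n + 1)) ℂ) j.succ 0‖ : ℂ)) ^ 2 =
        star ((A : Matrix (Fin (n + 1)) (Fin (n + 1)) ℂ) j.succ 0) *
          (A : Matrix (Fin (n + 1)) (Fin (n + 1)) ℂ) j.succ 0 := fun j => (Complex.conj_mul' _).symm
      simp_rw [h5]
      linear_combination h1
    exact_mod_cast h4
  intro i
  refine Fin.cases ?_ (fun i => ?_) i
  · simp [h]
  · have := (Finset.sum_eq_zero_iff_of_nonneg (fun i _ => by positivity)).1 h2 i (Finset.mem_univ _)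
    simpa [Matrix.one_apply] using this

/-- the exponential moment -/
noncomputable def MM {n : ℕ} (μ : Measure (Matrix.unitaryGroup (Fin n) ℂ)) (t : ℝ) : ENNReal :=
  ∫⁻ A : Matrix.unitaryGroup (Fin n) ℂ, ENNReal.ofReal (Real.exp (t * TT (A : Matrix (Fin n) (Fin n) ℂ))) ∂μ

/-- block embedding as a map of unitary groups -/
def iotaU {n : ℕ} (V : Matrix.unitaryGroup (Fin n) ℂ) : Matrix.unitaryGroup (Fin (n + 1)) ℂ :=
  ⟨iota V, iota_mem V.2⟩

lemma continuous_iotaU {n : ℕ} : Continuous (iotaU (n := n)) := by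
  apply Continuous.subtype_mk
  apply continuous_matrix
  intro i j
  have hent : ∀ i j, Continuous fun V : Matrix.unitaryGroup (Fin n) ℂ => (V : Matrix (Fin n) (Fin n) ℂ) i j :=
    fun i j => (continuous_apply_apply i j).comp continuous_subtype_val
  refine Fin.cases ?_ (fun i => ?_) i <;> refine Fin.cases ?_ (fun j => ?_) j
  · simpa using continuous_const
  · simpa using continuous_const
  · simpa using continuous_const
  · simpa using hent i j

lemma MM_succ {n : ℕ} (μ : Measure (Matrix.unitaryGroup (Fin n) ℂ)) [μ.IsHaarMeasure]
    [IsProbabilityMeasure μ] (ν : Measure (Matrix.unitaryGroup (Fin (n + 1)) ℂ)) [ν.IsHaarMeasure]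
    [IsProbabilityMeasure ν] (t : ℝ) :
    MM ν t = MM μ t * ∫⁻ A : Matrix.unitaryGroup (Fin (n + 1)) ℂ, ENNReal.ofReal (Real.exp (t *
      Complex.arg (1 - (A : Matrix (Fin (n + 1)) (Fin (n + 1)) ℂ) 0 0))) ∂ν := by
  set F : Matrix.unitaryGroup (Fin (n + 1)) ℂ → ENNReal := fun A =>
    ENNReal.ofReal (Real.exp (t * TT (A : Matrix (Fin (n + 1)) (Fin (n + 1)) ℂ))) with hF
  have hFm : Measurable F :=
    ENNReal.measurable_ofReal.comp (Real.measurable_exp.comp (measurable_TT.const_mul t))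
  have h1 : MM ν t = ∫⁻ V, ∫⁻ A, F (A * iotaU V) ∂ν ∂μ := by
    simp_rw [lintegral_mul_right_eq_self F]
    simp [MM, hF]
  rw [h1, lintegral_lintegral_swap]
  · rw [← lintegral_const_mul']
    · apply lintegral_congr_ae
      filter_upwards [null_entry ν] with A hA
      obtain ⟨u, hu0, huu, W, hW, hAW⟩ := exists_decomp _ A.2 hA
      have hu0' : u 0 ≠ 0 := by rw [hu0]; exact sub_ne_zero.2 hA.symm
      have h2 : ∀ V : Matrix.unitaryGroup (Fin n) ℂ, F (A * iotaU V) =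
          (fun V : Matrix.unitaryGroup (Fin n) ℂ =>
            ENNReal.ofReal (Real.exp (t * TT (refl u * iota (V : Matrix (Fin n) (Fin n) ℂ)))))
              ((⟨W, hW⟩ : Matrix.unitaryGroup (Fin n) ℂ) * V) := by
        intro V
        simp only [hF]
        have : ((A * iotaU V : Matrix.unitaryGroup (Fin (n + 1)) ℂ) :
            Matrix (Fin (n + 1)) (Fin (n + 1)) ℂ) = refl u * iota (W * (V : Matrix (Fin n) (Fin n) ℂ)) := by
          rw [iota_mul, ← mul_assoc, ← hAW]
          rfl
        rw [this]
        rfl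
      simp_rw [h2]
      rw [lintegral_mul_left_eq_self (μ := μ) (fun V : Matrix.unitaryGroup (Fin n) ℂ =>
            ENNReal.ofReal (Real.exp (t * TT (refl u * iota (V : Matrix (Fin n) (Fin n) ℂ)))))]
      rw [MM, ← lintegral_mul_const']
      · apply lintegral_congr_ae
        filter_upwards [null_det μ] with V hV
        rw [key hu0' huu V V.2 hV, ← hu0, mul_add, Real.exp_add,
          ENNReal.ofReal_mul (Real.exp_pos _).le]
      · exact ENNReal.ofReal_ne_top
    · have : ∃ C : ℝ, ∀ A : Matrix.unitaryGroup (Fin n) ℂ,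
          TT (A : Matrix (Fin n) (Fin n) ℂ) * t ≤ C := by
        refine ⟨n * (π * |t|), fun A => ?_⟩
        rw [TT, ← Multiset.sum_map_mul_right]
        have := Multiset.sum_le_card_nsmul ((A : Matrix (Fin n) (Fin n) ℂ).charpoly.roots.map
          fun l => (Complex.log (1 - l)).im * t) (π * |t|) (by
            intro x hx
            obtain ⟨l, _, rfl⟩ := Multiset.mem_map.1 hx
            rw [Complex.log_im]
            calc Complex.arg (1 - l) * t ≤ |Complex.arg (1 - l) * t| := le_abs_self _
              _ = |Complex.arg (1 - l)| * |t| := abs_mul _ _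
              _ ≤ π * |t| := by
                gcongr
                exact Complex.abs_arg_le_pi _)
        rw [Multiset.card_map, card_roots, nsmul_eq_mul] at this
        exact this
      obtain ⟨C, hC⟩ := this
      apply ne_of_lt
      calc MM μ t ≤ ∫⁻ _, ENNReal.ofReal (Real.exp C) ∂μ := by
            apply lintegral_mono
            intro A
            apply ENNReal.ofReal_le_ofReal
            apply Real.exp_le_exp.2
            rw [mul_comm]
            exact hC A
        _ < ⊤ := by simp
  · apply Measurable.aemeasurable
    apply hFm.comp
    apply Continuous.measurable
    exact continuous_snd.mul (continuous_iotaU.comp continuous_fst)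

end ArgMax

namespace ArgMax
open scoped Topology

/-- the entries of the first column -/
noncomputable def ent {n : ℕ} (i : Fin (n + 1)) (A : Matrix.unitaryGroup (Fin (n + 1)) ℂ) : ℂ :=
  (A : Matrix (Fin (n + 1)) (Fin (n + 1)) ℂ) i 0

lemma continuous_ent {n : ℕ} (i : Fin (n + 1)) : Continuous (ent i) :=
  (continuous_apply_apply i 0).comp continuous_subtype_val

lemma ent_scal {n : ℕ} (c : ℂ) (hc : ‖c‖ = 1) (A : Matrix.unitaryGroup (Fin (n + 1)) ℂ)
    (i : Fin (n + 1)) : ent i (scal (n + 1) c hc * A) = c * ent i A := by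
  rw [ent, scal_mul]; rfl

lemma ent_norm_le {n : ℕ} (A : Matrix.unitaryGroup (Fin (n + 1)) ℂ) (i : Fin (n + 1)) :
    ‖ent i A‖ ≤ 1 := entry_norm_bound_of_unitary A.2 i 0

lemma ent_sum {n : ℕ} (A : Matrix.unitaryGroup (Fin (n + 1)) ℂ) :
    ∑ i, ‖ent i A‖ ^ 2 = 1 := by
  have h1 := congrFun (congrFun (Matrix.mem_unitaryGroup_iff'.1 A.2) 0) 0
  rw [Matrix.mul_apply] at h1
  have h4 : ((∑ i, ‖ent i A‖ ^ 2 : ℝ) : ℂ) = 1 := by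
    push_cast
    rw [Matrix.one_apply_eq] at h1
    rw [← h1]
    apply Finset.sum_congr rfl
    intro j _
    exact (Complex.conj_mul' _).symm
  exact_mod_cast h4

lemma perm_mem {n : ℕ} (σ : Equiv.Perm (Fin n)) :
    (σ.permMatrix ℂ) ∈ Matrix.unitaryGroup (Fin n) ℂ := by
  rw [Matrix.mem_unitaryGroup_iff, PEquiv.toMatrix_toPEquiv_mul]
  ext i j
  simp [Matrix.star_apply, PEquiv.toMatrix_apply, Matrix.one_apply, Equiv.toPEquiv]
  simp [eq_comm]

/-- permutation matrices as unitary matrices -/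
noncomputable def permU {n : ℕ} (σ : Equiv.Perm (Fin n)) : Matrix.unitaryGroup (Fin n) ℂ :=
  ⟨σ.permMatrix ℂ, perm_mem σ⟩

lemma ent_perm {n : ℕ} (σ : Equiv.Perm (Fin (n + 1))) (A : Matrix.unitaryGroup (Fin (n + 1)) ℂ)
    (i : Fin (n + 1)) : ent i (permU σ * A) = ent (σ i) A := by
  have : ((permU σ * A : Matrix.unitaryGroup (Fin (n + 1)) ℂ) :
      Matrix (Fin (n + 1)) (Fin (n + 1)) ℂ) = (σ.permMatrix ℂ) * (A : Matrix _ _ ℂ) := rfl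
  rw [ent, this, PEquiv.toMatrix_toPEquiv_mul]
  rfl

lemma exists_rot {n : ℕ} (s : ℝ) (hs : s ^ 2 = 1) : ∃ R : Matrix.unitaryGroup (Fin (n + 2)) ℂ,
    ∀ A : Matrix.unitaryGroup (Fin (n + 2)) ℂ,
      ent 0 (R * A) = ((√2)⁻¹ : ℝ) * (ent 0 A + s * ent 1 A) := by
  have h2 : (√2 : ℝ) ^ 2 = 2 := Real.sq_sqrt (by norm_num)
  have hpos : (0:ℝ) < √2 := by positivity
  have h1 : 1 - (√2 : ℝ)⁻¹ ≠ 0 := by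
    intro h
    field_simp at h
    nlinarith
  set q : ℝ := (√2)⁻¹ with hq
  have hq2 : q ^ 2 = 1 / 2 := by rw [hq, inv_pow, h2]; norm_num
  set u : Fin (n + 2) → ℂ := Fin.cons ((1 - q : ℝ) : ℂ) (Fin.cons ((- s * q : ℝ) : ℂ) 0) with hu
  have hu0 : u 0 = ((1 - q : ℝ) : ℂ) := rfl
  have hu1 : u 1 = ((- s * q : ℝ) : ℂ) := rfl
  have hu2 : ∀ i : Fin n, u i.succ.succ = 0 := fun i => rfl
  have hmem : refl u ∈ Matrix.unitaryGroup (Fin (n + 2)) ℂ := by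
    apply refl_mem
    · rw [hu0]; exact_mod_cast h1
    · rw [dotProduct, Fin.sum_univ_succ, Fin.sum_univ_succ]
      simp only [hu2, mul_zero, Finset.sum_const_zero, add_zero, Pi.star_apply]
      rw [show (Fin.succ (0 : Fin (n + 1))) = 1 from rfl, hu0, hu1]
      simp only [Complex.star_def, Complex.conj_ofReal]
      norm_cast
      nlinarith
  refine ⟨⟨refl u, hmem⟩, fun A => ?_⟩
  have : (((⟨refl u, hmem⟩ : Matrix.unitaryGroup (Fin (n + 2)) ℂ) * A :
    Matrix.unitaryGroup (Fin (n + 2)) ℂ) : Matrix (Fin (n + 2)) (Fin (n + 2)) ℂ) =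
      refl u * (A : Matrix _ _ ℂ) := rfl
  rw [ent, this, refl_mul]
  simp only [Matrix.sub_apply, Matrix.smul_apply, Matrix.vecMulVec_apply, Matrix.vecMul,
    dotProduct, smul_eq_mul]
  rw [Fin.sum_univ_succ, Fin.sum_univ_succ]
  simp only [Pi.star_apply, hu2, star_zero, zero_mul, Finset.sum_const_zero, add_zero]
  rw [show (Fin.succ (0 : Fin (n + 1))) = 1 from rfl, hu0, hu1]
  simp only [Complex.star_def, Complex.conj_ofReal]
  have h1' : ((1 - q : ℝ) : ℂ) ≠ 0 := by exact_mod_cast h1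
  rw [← mul_assoc, inv_mul_cancel₀ h1', one_mul]
  simp only [ent]
  push_cast
  ring

section mom
variable {n : ℕ} (ν : Measure (Matrix.unitaryGroup (Fin (n + 1)) ℂ)) [ν.IsHaarMeasure]
    [IsProbabilityMeasure ν]

lemma integrable_of_cont {f : Matrix.unitaryGroup (Fin (n + 1)) ℂ → ℝ} (hf : Continuous f) :
    Integrable f ν :=
  hf.integrable_of_hasCompactSupport (HasCompactSupport.of_compactSpace f)

lemma mom2 : ∫ A, ‖ent 0 A‖ ^ 2 ∂ν = 1 / ((n : ℝ) + 1) := by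
  have h1 : ∀ i, ∫ A, ‖ent i A‖ ^ 2 ∂ν = ∫ A, ‖ent 0 A‖ ^ 2 ∂ν := by
    intro i
    rw [← integral_mul_left_eq_self (fun A => ‖ent 0 A‖ ^ 2) (permU (Equiv.swap 0 i))]
    simp [ent_perm]
  have h2 : ∫ A, (∑ i, ‖ent i A‖ ^ 2) ∂ν = 1 := by simp [ent_sum]
  rw [integral_finsetSum] at h2
  · simp only [h1, Finset.sum_const, Finset.card_univ, Fintype.card_fin, nsmul_eq_mul] at h2
    push_cast at h2
    field_simp
    linarith
  · intro i _
    exact integrable_of_cont ν ((continuous_ent i).norm.pow 2)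

lemma mom_im : ∫ A, (ent 0 A).im ∂ν = 0 := by
  have h := integral_mul_left_eq_self (μ := ν) (fun A => (ent 0 A).im) (scal (n + 1) (-1) (by simp))
  simp only [ent_scal, neg_one_mul, Complex.neg_im] at h
  rw [integral_neg] at h
  linarith

lemma mom_im_sq : ∫ A, ((ent 0 A) ^ 2).im ∂ν = 0 := by
  have h := integral_mul_left_eq_self (μ := ν) (fun A => ((ent 0 A) ^ 2).im) (scal (n + 1) I (by simp))
  simp only [ent_scal, mul_pow, I_sq, neg_one_mul, Complex.neg_im] at h
  rw [integral_neg] at h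
  linarith

lemma mom_sq_im : ∫ A, ((ent 0 A).im) ^ 2 ∂ν = 1 / (2 * ((n : ℝ) + 1)) := by
  have h := integral_mul_left_eq_self (μ := ν) (fun A => ((ent 0 A).im) ^ 2) (scal (n + 1) I (by simp))
  simp only [ent_scal, Complex.I_mul_im] at h
  have h2 := mom2 ν
  have h3 : ∀ A : Matrix.unitaryGroup (Fin (n + 1)) ℂ, ‖ent 0 A‖ ^ 2 =
      (ent 0 A).re ^ 2 + (ent 0 A).im ^ 2 := by
    intro A
    rw [Complex.sq_norm, Complex.normSq_apply]; ring
  simp_rw [h3] at h2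
  rw [integral_add, h] at h2
  · field_simp at h2 ⊢
    linarith
  · exact integrable_of_cont ν ((Complex.continuous_re.comp (continuous_ent 0)).pow 2)
  · exact integrable_of_cont ν ((Complex.continuous_im.comp (continuous_ent 0)).pow 2)

end mom

lemma mom4_aux {n : ℕ} (ν : Measure (Matrix.unitaryGroup (Fin (n + 2)) ℂ)) [ν.IsHaarMeasure]
    [IsProbabilityMeasure ν] :
    ∫ A, ‖ent 0 A‖ ^ 4 ∂ν ≤ 3 * ∫ A, ‖ent 0 A‖ ^ 2 * ‖ent 1 A‖ ^ 2 ∂ν := by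
  obtain ⟨R, hR⟩ := exists_rot (n := n) 1 (by norm_num)
  obtain ⟨R', hR'⟩ := exists_rot (n := n) (-1) (by norm_num)
  have e1 := integral_mul_left_eq_self (μ := ν) (fun A => ‖ent 0 A‖ ^ 4) R
  have e2 := integral_mul_left_eq_self (μ := ν) (fun A => ‖ent 0 A‖ ^ 4) R'
  have e3 := integral_mul_left_eq_self (μ := ν) (fun A => ‖ent 0 A‖ ^ 4) (permU (Equiv.swap 0 1))
  simp only [hR, hR', ent_perm, Equiv.swap_apply_left] at e1 e2 e3
  have c0 := continuous_ent (n := n + 1) 0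
  have c1 := continuous_ent (n := n + 1) 1
  have hquart : ∀ (a b : ℂ), ‖(((√2)⁻¹ : ℝ) : ℂ) * (a + (1:ℝ) * b)‖ ^ 4 +
      ‖(((√2)⁻¹ : ℝ) : ℂ) * (a + ((-1 : ℝ)) * b)‖ ^ 4 ≤
      (1/2) * ‖a‖ ^ 4 + (1/2) * ‖b‖ ^ 4 + 3 * (‖a‖ ^ 2 * ‖b‖ ^ 2) := by
    intro a b
    have h2 : (√2 : ℝ) ^ 2 = 2 := Real.sq_sqrt (by norm_num)
    have h4 : ((√2 : ℝ)⁻¹) ^ 4 = 1 / 4 := by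
      rw [inv_pow, show (√2 : ℝ) ^ 4 = ((√2 : ℝ) ^ 2) ^ 2 by ring, h2]; norm_num
    have e : ∀ z : ℂ, ‖z‖ ^ 4 = (z.re ^ 2 + z.im ^ 2) ^ 2 := by
      intro z
      rw [show ‖z‖ ^ 4 = (‖z‖ ^ 2) ^ 2 by ring, Complex.sq_norm, Complex.normSq_apply]; ring
    have e' : ∀ z : ℂ, ‖z‖ ^ 2 = (z.re ^ 2 + z.im ^ 2) := by
      intro z
      rw [Complex.sq_norm, Complex.normSq_apply]; ring
    rw [norm_mul, norm_mul, mul_pow, mul_pow, Complex.norm_real, Real.norm_eq_abs,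
      abs_of_nonneg (by positivity), h4, e, e, e, e, e', e']
    simp
    nlinarith [sq_nonneg (a.re * b.im - a.im * b.re)]
  have key : ∫ A, (‖(((√2)⁻¹ : ℝ) : ℂ) * (ent 0 A + (1:ℝ) * ent 1 A)‖ ^ 4 +
      ‖(((√2)⁻¹ : ℝ) : ℂ) * (ent 0 A + ((-1 : ℝ)) * ent 1 A)‖ ^ 4) ∂ν ≤
      ∫ A, ((1/2) * ‖ent 0 A‖ ^ 4 + (1/2) * ‖ent 1 A‖ ^ 4 + 3 * (‖ent 0 A‖ ^ 2 * ‖ent 1 A‖ ^ 2)) ∂ν := by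
    apply integral_mono
    · exact integrable_of_cont ν (by fun_prop)
    · exact integrable_of_cont ν (by fun_prop)
    · intro A
      exact hquart _ _
  rw [integral_add, integral_add, integral_add, integral_const_mul, integral_const_mul,
    integral_const_mul, e1, e2, e3] at key
  · linarith
  all_goals exact integrable_of_cont ν (by fun_prop)

lemma mom4 {n : ℕ} (ν : Measure (Matrix.unitaryGroup (Fin (n + 1)) ℂ)) [ν.IsHaarMeasure]
    [IsProbabilityMeasure ν] : ∫ A, ‖ent 0 A‖ ^ 4 ∂ν ≤ 6 / ((n : ℝ) + 1) ^ 2 := by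
  cases n with
  | zero =>
    calc ∫ A, ‖ent 0 A‖ ^ 4 ∂ν ≤ ∫ A, (1:ℝ) ∂ν := by
          apply integral_mono
          · exact integrable_of_cont ν ((continuous_ent 0).norm.pow 4)
          · exact integrable_const _
          · intro A
            exact pow_le_one₀ (norm_nonneg _) (ent_norm_le _ _)
      _ ≤ _ := by simp
  | succ n =>
    have h1 := mom4_aux ν
    have h2 := mom2 ν
    have h3 : ∀ i : Fin n, ∫ A, ‖ent 0 A‖ ^ 2 * ‖ent i.succ.succ A‖ ^ 2 ∂ν =
        ∫ A, ‖ent 0 A‖ ^ 2 * ‖ent 1 A‖ ^ 2 ∂ν := by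
      intro i
      rw [← integral_mul_left_eq_self (fun A => ‖ent 0 A‖ ^ 2 * ‖ent 1 A‖ ^ 2)
        (permU (Equiv.swap 1 i.succ.succ))]
      simp only [ent_perm, Equiv.swap_apply_left]
      rw [Equiv.swap_apply_of_ne_of_ne]
      · exact zero_ne_one
      · exact (Fin.succ_ne_zero _).symm
    have cc : ∀ i, Continuous (ent (n := n + 1) i) := continuous_ent
    have h4 : ∫ A, ‖ent 0 A‖ ^ 2 ∂ν = ∫ A, (‖ent 0 A‖ ^ 4 + (‖ent 0 A‖ ^ 2 * ‖ent 1 A‖ ^ 2 +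
        ∑ i : Fin n, ‖ent 0 A‖ ^ 2 * ‖ent i.succ.succ A‖ ^ 2)) ∂ν := by
      congr 1
      ext A
      have := ent_sum A
      rw [Fin.sum_univ_succ, Fin.sum_univ_succ,
        show (Fin.succ (0 : Fin (n + 1))) = 1 from rfl] at this
      rw [← Finset.mul_sum, ← mul_add]
      calc ‖ent 0 A‖ ^ 2 = ‖ent 0 A‖ ^ 2 * 1 := by ring
        _ = _ := by rw [← this]; ring
    rw [integral_add, integral_add, integral_finsetSum] at h4
    · simp only [h3, Finset.sum_const, Finset.card_univ, Fintype.card_fin, nsmul_eq_mul] at h4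
      rw [h2] at h4
      push_cast at h4 ⊢
      set x := ∫ A, ‖ent 0 A‖ ^ 4 ∂ν
      set y := ∫ A, ‖ent 0 A‖ ^ 2 * ‖ent 1 A‖ ^ 2 ∂ν
      have hn : (0:ℝ) ≤ n := Nat.cast_nonneg n
      have hx : 0 ≤ x := integral_nonneg fun A => by positivity
      have h5 : 1 / ((n:ℝ) + 1 + 1) ≥ (n + 2) / 6 * x := by
        rw [h4]
        have : x / 3 ≤ y := by linarith
        have : (x / 3) * (n + 1) ≤ y * (n + 1) := by gcongr
        nlinarith
      rw [ge_iff_le, le_div_iff₀ (by positivity)] at h5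
      rw [le_div_iff₀ (by positivity)]
      nlinarith
    · intro i _
      exact integrable_of_cont ν (by fun_prop)
    all_goals exact integrable_of_cont ν (by fun_prop)

end ArgMax

namespace ArgMax
open scoped Topology

lemma exp_le_cubic {x M : ℝ} (hx : |x| ≤ M) :
    Real.exp x ≤ 1 + x + x ^ 2 / 2 + |x| ^ 3 * Real.exp M := by
  have hM : 0 ≤ M := (abs_nonneg x).trans hx
  have h1 : 1 ≤ Real.exp M := Real.one_le_exp hM
  by_cases h : |x| ≤ 1
  · have := Real.exp_bound h (n := 3) (by norm_num)
    simp [Finset.sum_range_succ, Nat.factorial] at this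
    have h2 := (abs_le.1 this).2
    have h3 : |x| ^ 3 * 1 ≤ |x| ^ 3 * Real.exp M := by gcongr
    have h4 : 0 ≤ |x| ^ 3 := by positivity
    norm_num at h2
    nlinarith
  · push Not at h
    have h2 : Real.exp x ≤ Real.exp M := Real.exp_le_exp.2 ((le_abs_self x).trans hx)
    have h3 : 1 ≤ |x| ^ 3 := one_le_pow₀ h.le
    nlinarith [sq_nonneg (x + 1), Real.exp_pos M]

lemma pointwise (t : ℝ) : ∃ C : ℝ, 0 ≤ C ∧ ∀ w : ℂ, ‖w‖ ≤ 1 →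
    Real.exp (t * Complex.arg (1 - w)) ≤ 1 - t * (w.im + (w ^ 2).im / 2) + t ^ 2 / 2 * w.im ^ 2 +
      C * ‖w‖ ^ 3 := by
  set E := Real.exp (π * |t|) with hE
  have hEp : 0 < E := Real.exp_pos _
  refine ⟨8 * E + 12 * |t| + 3 / 2 * t ^ 2 + 4 * (|t| ^ 3 * E), by positivity, ?_⟩
  intro w hw
  have harg : |t * Complex.arg (1 - w)| ≤ π * |t| := by
    rw [abs_mul, mul_comm]
    gcongr
    exact Complex.abs_arg_le_pi _
  have hr0 : 0 ≤ ‖w‖ := norm_nonneg w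
  have him : |w.im| ≤ ‖w‖ := Complex.abs_im_le_norm w
  by_cases h : ‖w‖ ≤ 1 / 2
  · have hlt : ‖-w‖ < 1 := by rw [norm_neg]; linarith
    have hinv : (1 - ‖w‖)⁻¹ ≤ 2 := by
      rw [inv_le_comm₀ (by linarith) (by norm_num)]; linarith
    have b1 := Complex.norm_log_sub_logTaylor_le 2 hlt
    have b2 := Complex.norm_log_one_add_sub_self_le hlt
    have b3 := Complex.norm_log_one_add_half_le_self (z := -w) (by rw [norm_neg]; exact h)
    rw [norm_neg] at b1 b2 b3
    simp only [Complex.logTaylor_succ, Complex.logTaylor_zero] at b1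
    norm_num at b1
    rw [← sub_eq_add_neg] at b1 b2 b3
    set a := Complex.arg (1 - w) with ha
    have hla : (Complex.log (1 - w)).im = a := Complex.log_im _
    have c3 : |a| ≤ 3 / 2 * ‖w‖ := by
      rw [← hla]; exact (Complex.abs_im_le_norm _).trans b3
    have c2 : |a + w.im| ≤ ‖w‖ ^ 2 := by
      have := (Complex.abs_im_le_norm _).trans b2
      simp only [Complex.add_im, hla, sub_neg_eq_add] at this
      refine this.trans ?_
      have : ‖w‖ ^ 2 * (1 - ‖w‖)⁻¹ ≤ ‖w‖ ^ 2 * 2 := by gcongr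
      linarith
    have c1 : |a + (w.im + (w ^ 2).im / 2)| ≤ ‖w‖ ^ 3 := by
      have := (Complex.abs_im_le_norm _).trans b1
      have e : (Complex.log (1 - w) - (-w + -w ^ 2 / 2)).im = a + (w.im + (w ^ 2).im / 2) := by
        simp only [Complex.sub_im, Complex.add_im, Complex.neg_im, hla]
        have : (-w ^ 2 / 2).im = -(w ^ 2).im / 2 := by
          rw [← Complex.neg_im]
          exact Complex.div_ofNat_im (-w ^ 2) 2
        rw [this]; ring
      rw [e] at this
      refine this.trans ?_
      have : ‖w‖ ^ 3 * (1 - ‖w‖)⁻¹ ≤ ‖w‖ ^ 3 * 2 := by gcongr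
      nlinarith [pow_nonneg hr0 3]
    have d := exp_le_cubic harg
    have d1 : t * a ≤ -(t * (w.im + (w ^ 2).im / 2)) + |t| * ‖w‖ ^ 3 := by
      have : t * (a + (w.im + (w ^ 2).im / 2)) ≤ |t| * ‖w‖ ^ 3 := by
        refine (le_abs_self _).trans ?_
        rw [abs_mul]; gcongr
      linarith
    have d2 : a ^ 2 ≤ w.im ^ 2 + 3 * ‖w‖ ^ 3 := by
      have e : a ^ 2 = w.im ^ 2 - 2 * ((a + w.im) * w.im) + |a + w.im| ^ 2 := by
        rw [sq_abs]; ring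
      have f1 : - ((a + w.im) * w.im) ≤ ‖w‖ ^ 3 := by
        refine (neg_le_abs _).trans ?_
        rw [abs_mul, pow_succ]; gcongr
      have f2 : |a + w.im| ^ 2 ≤ (‖w‖ ^ 2) ^ 2 := by gcongr
      have f3 : (‖w‖ ^ 2) ^ 2 ≤ ‖w‖ ^ 3 := by
        have : ‖w‖ ^ 3 * ‖w‖ ≤ ‖w‖ ^ 3 * 1 := by gcongr
        nlinarith
      linarith
    have d3 : |t * a| ^ 3 * E ≤ 4 * (|t| ^ 3 * E) * ‖w‖ ^ 3 := by
      have : |t * a| ^ 3 ≤ (|t| * (3 / 2 * ‖w‖)) ^ 3 := by rw [abs_mul]; gcongr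
      calc |t * a| ^ 3 * E ≤ (|t| * (3 / 2 * ‖w‖)) ^ 3 * E := by gcongr
        _ = 27 / 8 * (|t| ^ 3 * E * ‖w‖ ^ 3) := by ring
        _ ≤ 4 * (|t| ^ 3 * E * ‖w‖ ^ 3) := by gcongr; norm_num
        _ = _ := by ring
    have d4 : (t * a) ^ 2 / 2 ≤ t ^ 2 / 2 * w.im ^ 2 + 3 / 2 * t ^ 2 * ‖w‖ ^ 3 := by
      have : t ^ 2 / 2 * a ^ 2 ≤ t ^ 2 / 2 * (w.im ^ 2 + 3 * ‖w‖ ^ 3) := by gcongr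
      nlinarith
    have p1 : 0 ≤ E * ‖w‖ ^ 3 := by positivity
    have p2 : 0 ≤ |t| * ‖w‖ ^ 3 := by positivity
    nlinarith
  · push Not at h
    have h8 : 1 ≤ 8 * ‖w‖ ^ 3 := by
      have : (1/2 : ℝ) ^ 3 ≤ ‖w‖ ^ 3 := by gcongr
      norm_num at this; linarith
    have h1 : Real.exp (t * Complex.arg (1 - w)) ≤ E :=
      Real.exp_le_exp.2 ((le_abs_self _).trans harg)
    have h2 : t * (w.im + (w ^ 2).im / 2) ≤ |t| * (3 / 2) := by
      refine (le_abs_self _).trans ?_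
      rw [abs_mul]
      gcongr
      have := Complex.abs_im_le_norm (w ^ 2)
      rw [norm_pow] at this
      have h3 : ‖w‖ ^ 2 ≤ 1 := pow_le_one₀ hr0 hw
      refine (abs_add_le _ _).trans ?_
      rw [abs_div, abs_two]
      linarith
    have p1 : E * 1 ≤ E * (8 * ‖w‖ ^ 3) := by gcongr
    have p2 : |t| * (3 / 2) * 1 ≤ |t| * (3 / 2) * (8 * ‖w‖ ^ 3) := by gcongr
    have p3 : 0 ≤ t ^ 2 / 2 * w.im ^ 2 := by positivity
    have p4 : 0 ≤ 3 / 2 * t ^ 2 * ‖w‖ ^ 3 := by positivity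
    have p5 : 0 ≤ 4 * (|t| ^ 3 * E) * ‖w‖ ^ 3 := by positivity
    nlinarith

lemma factor (t : ℝ) : ∃ C : ℝ, 0 ≤ C ∧ ∀ (n : ℕ) (ν : Measure (Matrix.unitaryGroup (Fin (n + 1)) ℂ))
    [ν.IsHaarMeasure] [IsProbabilityMeasure ν],
    ∫⁻ A : Matrix.unitaryGroup (Fin (n + 1)) ℂ, ENNReal.ofReal (Real.exp (t *
      Complex.arg (1 - (A : Matrix (Fin (n + 1)) (Fin (n + 1)) ℂ) 0 0))) ∂ν ≤
    ENNReal.ofReal (Real.exp (t ^ 2 / 4 * (1 / ((n:ℝ) + 1)) + C / (((n:ℝ) + 1) * √((n:ℝ) + 1)))) := by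
  obtain ⟨C, hC, h⟩ := pointwise t
  refine ⟨C * (7 / 2), by positivity, ?_⟩
  intro n ν _ _
  have cc := continuous_ent (n := n) 0
  have hs : 0 < √((n:ℝ) + 1) := Real.sqrt_pos.2 (by positivity)
  have hs2 : √((n:ℝ) + 1) ^ 2 = n + 1 := Real.sq_sqrt (by positivity)
  set s := √((n:ℝ) + 1) with hsd
  set G : Matrix.unitaryGroup (Fin (n + 1)) ℂ → ℝ := fun A =>
    (1 + (-t) * (ent 0 A).im) + (-t / 2) * ((ent 0 A) ^ 2).im + t ^ 2 / 2 * (ent 0 A).im ^ 2 +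
      (C / (2 * s)) * ‖ent 0 A‖ ^ 2 + (C * s / 2) * ‖ent 0 A‖ ^ 4 with hG
  have hG1 : ∀ A, Real.exp (t * Complex.arg (1 - ent 0 A)) ≤ G A := by
    intro A
    refine (h _ (ent_norm_le A 0)).trans ?_
    have : ‖ent 0 A‖ ^ 3 ≤ (1 / (2 * s)) * ‖ent 0 A‖ ^ 2 + (s / 2) * ‖ent 0 A‖ ^ 4 := by
      have h1 : 0 ≤ ‖ent 0 A‖ ^ 2 * (1 - s * ‖ent 0 A‖) ^ 2 / (2 * s) := by positivity
      have h2 : ‖ent 0 A‖ ^ 2 * (1 - s * ‖ent 0 A‖) ^ 2 / (2 * s) =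
        (1 / (2 * s)) * ‖ent 0 A‖ ^ 2 + (s / 2) * ‖ent 0 A‖ ^ 4 - ‖ent 0 A‖ ^ 3 := by
        field_simp
        ring
      linarith
    have h3 := mul_le_mul_of_nonneg_left this hC
    simp only [hG]
    have h4 : C * ((1 / (2 * s)) * ‖ent 0 A‖ ^ 2 + (s / 2) * ‖ent 0 A‖ ^ 4) =
      (C / (2 * s)) * ‖ent 0 A‖ ^ 2 + (C * s / 2) * ‖ent 0 A‖ ^ 4 := by ring
    linarith
  have hGc : Continuous G := by
    simp only [hG]
    fun_prop
  calc _ ≤ ∫⁻ A, ENNReal.ofReal (G A) ∂ν := by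
        apply lintegral_mono
        intro A
        exact ENNReal.ofReal_le_ofReal (hG1 A)
    _ = ENNReal.ofReal (∫ A, G A ∂ν) := by
        rw [ofReal_integral_eq_lintegral_ofReal (integrable_of_cont ν hGc)]
        filter_upwards with A
        exact (Real.exp_pos _).le.trans (hG1 A)
    _ ≤ _ := by
        apply ENNReal.ofReal_le_ofReal
        have e : ∫ A, G A ∂ν = 1 + t ^ 2 / 2 * (1 / (2 * ((n : ℝ) + 1))) +
            (C / (2 * s)) * (1 / ((n : ℝ) + 1)) + (C * s / 2) * ∫ A, ‖ent 0 A‖ ^ 4 ∂ν := by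
          simp only [hG]
          rw [integral_add, integral_add, integral_add, integral_add, integral_add,
            integral_const_mul, integral_const_mul, integral_const_mul, integral_const_mul,
            integral_const_mul, mom_im, mom_im_sq, mom_sq_im, mom2]
          · simp
          all_goals exact integrable_of_cont ν (by fun_prop)
        have m4 := mom4 ν
        have m5 : (C * s / 2) * ∫ A, ‖ent 0 A‖ ^ 4 ∂ν ≤ (C * s / 2) * (6 / ((n : ℝ) + 1) ^ 2) := by
          gcongr
        have m6 : (C / (2 * s)) * (1 / ((n : ℝ) + 1)) + (C * s / 2) * (6 / ((n : ℝ) + 1) ^ 2) =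
            C * (7 / 2) / (((n:ℝ) + 1) * s) := by
          rw [← hs2]
          field_simp
          ring
        have m7 : t ^ 2 / 2 * (1 / (2 * ((n : ℝ) + 1))) = t ^ 2 / 4 * (1 / ((n:ℝ) + 1)) := by
          field_simp; ring
        have := Real.add_one_le_exp (t ^ 2 / 4 * (1 / ((n:ℝ) + 1)) + C * (7 / 2) / (((n:ℝ) + 1) * s))
        linarith

lemma MM_zero (μ : Measure (Matrix.unitaryGroup (Fin 0) ℂ)) [IsProbabilityMeasure μ] (t : ℝ) :
    MM μ t = 1 := by
  have : ∀ A : Matrix (Fin 0) (Fin 0) ℂ, TT A = 0 := by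
    intro A
    have : A.charpoly.roots = 0 := Multiset.card_eq_zero.1 (card_roots A)
    simp [TT, this]
  simp [MM, this]

lemma MM_bound (t : ℝ) : ∃ K : ℝ, 0 ≤ K ∧ ∀ (μ : (n : ℕ) → Measure (Matrix.unitaryGroup (Fin n) ℂ)),
    (∀ n, (μ n).IsHaarMeasure) → (∀ n, IsProbabilityMeasure (μ n)) → ∀ n : ℕ, 1 ≤ n →
    MM (μ n) t ≤ ENNReal.ofReal (K * (n : ℝ) ^ (t ^ 2 / 4)) := by
  obtain ⟨C, hC, h⟩ := factor t
  have hsum : Summable fun j : ℕ => C / (((j:ℝ) + 1) * √((j:ℝ) + 1)) := by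
    have h1 : Summable fun j : ℕ => 1 / ((j:ℝ)) ^ (3/2 : ℝ) :=
      Real.summable_one_div_nat_rpow.2 (by norm_num)
    have h2 := ((summable_nat_add_iff 1).2 h1).mul_left C
    refine h2.congr fun j => ?_
    have hj : (0:ℝ) < (j:ℝ) + 1 := by positivity
    rw [show ((3:ℝ)/2) = 1 + 1/2 by norm_num]
    push_cast
    rw [Real.rpow_add hj, Real.rpow_one, ← Real.sqrt_eq_rpow]
    ring
  set S := ∑' j : ℕ, C / (((j:ℝ) + 1) * √((j:ℝ) + 1)) with hS
  refine ⟨Real.exp (t ^ 2 / 4 + S), (Real.exp_pos _).le, ?_⟩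
  intro μ h1 h2 n hn
  have ind : ∀ n : ℕ, MM (μ n) t ≤ ENNReal.ofReal (Real.exp (t ^ 2 / 4 * ∑ j ∈ Finset.range n,
      (1 / ((j:ℝ) + 1)) + ∑ j ∈ Finset.range n, C / (((j:ℝ) + 1) * √((j:ℝ) + 1)))) := by
    intro n
    induction n with
    | zero =>
      have := h2 0
      rw [MM_zero]
      simp
    | succ n ih =>
      have := h1 n
      have := h1 (n + 1)
      have := h2 n
      have := h2 (n + 1)
      rw [MM_succ (μ n) (μ (n + 1))]
      refine (mul_le_mul' ih (h n (μ (n + 1)))).trans ?_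
      rw [← ENNReal.ofReal_mul (Real.exp_pos _).le, ← Real.exp_add, Finset.sum_range_succ,
        Finset.sum_range_succ]
      apply le_of_eq
      congr 2
      ring
  refine (ind n).trans ?_
  apply ENNReal.ofReal_le_ofReal
  have hn0 : (0:ℝ) < n := by exact_mod_cast hn
  rw [Real.rpow_def_of_pos hn0, ← Real.exp_add]
  apply Real.exp_le_exp.2
  have a1 : ∑ j ∈ Finset.range n, C / (((j:ℝ) + 1) * √((j:ℝ) + 1)) ≤ S :=
    hsum.sum_le_tsum _ fun j _ => by positivity
  have a2 : ∑ j ∈ Finset.range n, (1 / ((j:ℝ) + 1)) ≤ 1 + Real.log n := by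
    have := harmonic_le_one_add_log n
    refine le_trans (le_of_eq ?_) this
    simp [harmonic]
  have a3 : t ^ 2 / 4 * ∑ j ∈ Finset.range n, (1 / ((j:ℝ) + 1)) ≤ t ^ 2 / 4 * (1 + Real.log n) := by
    gcongr
  linarith

end ArgMax

namespace ArgMax
open scoped Topology

lemma arg_one_sub_exp {ψ : ℝ} (h0 : 0 < ψ) (h1 : ψ < 2 * π) :
    (Complex.log (1 - Complex.exp (ψ * I))).im = (ψ - π) / 2 := by
  have e : 1 - Complex.exp (ψ * I) = ((2 * Real.sin (ψ / 2) : ℝ) : ℂ) *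
      (Complex.cos (((ψ - π) / 2 : ℝ) : ℂ) + Complex.sin (((ψ - π) / 2 : ℝ) : ℂ) * I) := by
    have hc : Real.cos ((ψ - π) / 2) = Real.sin (ψ / 2) := by
      rw [show (ψ - π) / 2 = ψ / 2 - π / 2 by ring, Real.cos_sub_pi_div_two]
    have hs : Real.sin ((ψ - π) / 2) = - Real.cos (ψ / 2) := by
      rw [show (ψ - π) / 2 = ψ / 2 - π / 2 by ring, Real.sin_sub_pi_div_two]
    rw [← Complex.ofReal_cos, ← Complex.ofReal_sin, hc, hs, Complex.exp_mul_I,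
      ← Complex.ofReal_cos, ← Complex.ofReal_sin]
    have d1 : Real.cos ψ = 2 * Real.cos (ψ / 2) ^ 2 - 1 := by
      rw [← Real.cos_two_mul]; ring_nf
    have d2 : Real.sin ψ = 2 * Real.sin (ψ / 2) * Real.cos (ψ / 2) := by
      rw [← Real.sin_two_mul]; ring_nf
    have d3 := Real.sin_sq_add_cos_sq (ψ / 2)
    rw [d1, d2]
    generalize Real.sin (ψ / 2) = x at d3
    generalize Real.cos (ψ / 2) = y at d3
    have d4 : (x:ℂ) ^ 2 + (y:ℂ) ^ 2 = 1 := by exact_mod_cast d3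
    push_cast
    linear_combination (-2) * d4
  rw [Complex.log_im, e, Complex.arg_mul_cos_add_sin_mul_I]
  · have := Real.sin_pos_of_pos_of_lt_pi (x := ψ / 2) (by linarith) (by linarith)
    positivity
  · constructor <;> linarith [Real.pi_pos]

lemma h_mono {l : ℂ} (hl : ‖l‖ = 1) (θ : ℝ) {δ : ℝ} (hδ0 : 0 ≤ δ) (hδ1 : δ < 2 * π) :
    (Complex.log (1 - Complex.exp ((θ + δ : ℝ) * I) / l)).im ≤
      (Complex.log (1 - Complex.exp (θ * I) / l)).im + δ / 2 := by
  have hpi := Real.pi_pos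
  obtain ⟨φ, hφ⟩ : ∃ φ : ℝ, l = Complex.exp (φ * I) := by
    refine ⟨Complex.arg l, ?_⟩
    have := Complex.norm_mul_exp_arg_mul_I l
    rw [hl] at this
    simpa using this.symm
  have hq : ∀ x : ℝ, Complex.exp (x * I) / l = Complex.exp ((x - φ : ℝ) * I) := by
    intro x
    rw [hφ, ← Complex.exp_sub]
    congr 1
    push_cast; ring
  rw [hq, hq]
  obtain ⟨ψ, ⟨hψ0, hψ1⟩, m, hm⟩ : ∃ ψ ∈ Set.Ico 0 (2 * π), ∃ m : ℤ, θ - φ = ψ + m * (2 * π) := by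
    refine ⟨toIcoMod Real.two_pi_pos 0 (θ - φ), ?_, toIcoDiv Real.two_pi_pos 0 (θ - φ), ?_⟩
    · simpa using toIcoMod_mem_Ico Real.two_pi_pos 0 (θ - φ)
    · have := toIcoMod_add_toIcoDiv_zsmul Real.two_pi_pos 0 (θ - φ)
      rw [zsmul_eq_mul] at this
      exact this.symm
  have hper : ∀ (x : ℝ) (m : ℤ), Complex.exp ((x + m * (2 * π) : ℝ) * I) = Complex.exp (x * I) := by
    intro x m
    rw [show ((x + m * (2 * π) : ℝ) : ℂ) * I = x * I + m * (2 * π * I) by push_cast; ring,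
      Complex.exp_add, Complex.exp_int_mul_two_pi_mul_I, mul_one]
  rw [show θ + δ - φ = (ψ + δ) + m * (2 * π) by linarith, hm, hper, hper]
  have hz : (Complex.log (1 - Complex.exp ((0 : ℝ) * I))).im = 0 := by simp
  by_cases h : ψ + δ < 2 * π
  · rcases hψ0.eq_or_lt with h0 | h0
    · rw [← h0, hz, zero_add]
      rcases hδ0.eq_or_lt with h2 | h2
      · rw [← h2, hz]; simp
      · rw [arg_one_sub_exp h2 hδ1]; linarith
    · rw [arg_one_sub_exp h0 hψ1, arg_one_sub_exp (by linarith) h]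
      linarith
  · push Not at h
    have := hper (ψ + δ - 2 * π) 1
    rw [show ψ + δ - 2 * π + ((1:ℤ):ℝ) * (2 * π) = ψ + δ by push_cast; ring] at this
    rw [this, arg_one_sub_exp (ψ := ψ) (by linarith) hψ1]
    rcases h.eq_or_lt with h2 | h2
    · rw [show ψ + δ - 2 * π = 0 by linarith, hz]
      linarith
    · rw [arg_one_sub_exp (by linarith) (by linarith)]
      linarith

/-- the sum of the principal arguments -/
noncomputable def SS {n : ℕ} (A : Matrix (Fin n) (Fin n) ℂ) (θ : ℝ) : ℝ :=
  (A.charpoly.roots.map (fun l => (Complex.log (1 - Complex.exp (θ * Complex.I) / l)).im)).sum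

lemma SS_mono {n : ℕ} (A : Matrix (Fin n) (Fin n) ℂ) (hA : A ∈ Matrix.unitaryGroup (Fin n) ℂ)
    (θ : ℝ) {δ : ℝ} (hδ0 : 0 ≤ δ) (hδ1 : δ < 2 * π) :
    SS A (θ + δ) ≤ SS A θ + n * (δ / 2) := by
  have h1 : SS A (θ + δ) ≤ (A.charpoly.roots.map
      (fun l => (Complex.log (1 - Complex.exp (θ * Complex.I) / l)).im + δ / 2)).sum := by
    apply Multiset.sum_map_le_sum_map
    intro l hl
    exact h_mono (norm_root A hA hl) θ hδ0 hδ1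
  rw [Multiset.sum_map_add, Multiset.map_const', Multiset.sum_replicate, card_roots,
    nsmul_eq_mul] at h1
  exact h1

lemma SS_eq {n : ℕ} (A : Matrix (Fin n) (Fin n) ℂ) (hA : A ∈ Matrix.unitaryGroup (Fin n) ℂ)
    (θ : ℝ) : SS A θ = - TT (Complex.exp ((-θ : ℝ) * I) • A) := by
  rw [TT, roots_smul _ _ (Complex.exp_ne_zero _), Multiset.map_map, SS, ← Multiset.sum_map_neg]
  congr 1
  apply Multiset.map_congr rfl
  intro l hl
  have hn := norm_root A hA hl
  simp only [Function.comp_apply]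
  have e : 1 - Complex.exp (θ * I) / l =
      (starRingEnd ℂ) (1 - Complex.exp ((-θ : ℝ) * I) * l) := by
    rw [map_sub, map_one, map_mul, ← Complex.exp_conj, map_mul, Complex.conj_I, Complex.conj_ofReal]
    have : (starRingEnd ℂ) l = l⁻¹ := by
      rw [Complex.inv_def, Complex.normSq_eq_norm_sq, hn]; simp
    rw [this, div_eq_mul_inv]
    push_cast
    ring_nf
  rw [e, Complex.log_conj, Complex.conj_im]
  intro harg
  have h1 := Complex.arg_eq_pi_iff.1 harg
  have h2 := Complex.abs_re_le_norm (Complex.exp ((-θ : ℝ) * I) * l)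
  rw [norm_mul, hn, Complex.norm_exp_ofReal_mul_I, mul_one] at h2
  have h3 := (abs_le.1 h2).2
  have h4 := h1.1
  rw [Complex.sub_re, Complex.one_re] at h4
  linarith

lemma grid {n : ℕ} (hn : 2 ≤ n) (A : Matrix (Fin n) (Fin n) ℂ)
    (hA : A ∈ Matrix.unitaryGroup (Fin n) ℂ) {B : ℝ}
    (hB : ∀ k ∈ Finset.range (n + 1), |SS A (2 * π * k / n)| ≤ B) {θ : ℝ}
    (hθ : θ ∈ Set.Ico 0 (2 * π)) : |SS A θ| ≤ B + π := by
  have hpi := Real.pi_pos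
  have hn2 : (2:ℝ) ≤ n := by exact_mod_cast hn
  have hn0 : (0:ℝ) < n := by linarith
  set x := θ * n / (2 * π) with hx
  have hx0 : 0 ≤ x := by have := hθ.1; positivity
  have hxn : x < n := by
    rw [hx, div_lt_iff₀ (by positivity)]
    have := hθ.2
    nlinarith
  set k := ⌊x⌋₊ with hk
  have hk1 : (k:ℝ) ≤ x := Nat.floor_le hx0
  have hk2 : x < k + 1 := Nat.lt_floor_add_one x
  have hkn : k < n := (Nat.floor_lt hx0).2 hxn
  have hθx : θ = 2 * π * x / n := by rw [hx]; field_simp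
  have b1 := hB k (Finset.mem_range.2 (by omega))
  have b2 := hB (k + 1) (Finset.mem_range.2 (by omega))
  push_cast at b2
  have hd : ∀ y : ℝ, y ≤ 1 → 2 * π * y / n < 2 * π := by
    intro y hy
    rw [div_lt_iff₀ hn0]
    nlinarith
  have m1 := SS_mono A hA (2 * π * k / n) (δ := 2 * π * (x - k) / n)
    (by have : 0 ≤ x - k := by linarith
        positivity) (hd _ (by linarith))
  have m2 := SS_mono A hA θ (δ := 2 * π * (k + 1 - x) / n)
    (by have : 0 ≤ k + 1 - x := by linarith
        positivity) (hd _ (by linarith))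
  rw [show 2 * π * k / n + 2 * π * (x - k) / n = θ by rw [hθx]; ring] at m1
  rw [show θ + 2 * π * (k + 1 - x) / n = 2 * π * (k + 1) / n by rw [hθx]; ring] at m2
  rw [show (n:ℝ) * (2 * π * (x - k) / n / 2) = π * (x - k) by field_simp] at m1
  rw [show (n:ℝ) * (2 * π * (k + 1 - x) / n / 2) = π * (k + 1 - x) by field_simp] at m2
  rw [abs_le] at b1 b2 ⊢
  constructor <;> nlinarith

lemma tail_one {n : ℕ} (hn : 1 ≤ n) (μ : Measure (Matrix.unitaryGroup (Fin n) ℂ)) {c s K : ℝ}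
    (hK : 0 ≤ K)
    (hs : s ^ 2 = 1) (hM : MM μ (2 * c * s) ≤ ENNReal.ofReal (K * (n:ℝ) ^ ((2 * c * s) ^ 2 / 4)))
    (hc : 0 < c) :
    μ {A | c * Real.log n ≤ s * TT (A : Matrix (Fin n) (Fin n) ℂ)} ≤
      ENNReal.ofReal (K * (n:ℝ) ^ (-c ^ 2)) := by
  have hn0 : (0:ℝ) < n := by exact_mod_cast hn
  have h1 := mul_meas_ge_le_lintegral (μ := μ)
    (f := fun A => ENNReal.ofReal (Real.exp ((2 * c * s) * TT (A : Matrix (Fin n) (Fin n) ℂ))))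
    (ENNReal.measurable_ofReal.comp (Real.measurable_exp.comp (measurable_TT.const_mul _)))
    (ENNReal.ofReal ((n:ℝ) ^ (2 * c ^ 2)))
  have h2 : {A : Matrix.unitaryGroup (Fin n) ℂ | c * Real.log n ≤ s * TT (A : Matrix (Fin n) (Fin n) ℂ)} ⊆
      {A | ENNReal.ofReal ((n:ℝ) ^ (2 * c ^ 2)) ≤
        ENNReal.ofReal (Real.exp ((2 * c * s) * TT (A : Matrix (Fin n) (Fin n) ℂ)))} := by
    intro A hA
    have hA' : c * Real.log n ≤ s * TT (A : Matrix (Fin n) (Fin n) ℂ) := hA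
    apply ENNReal.ofReal_le_ofReal
    rw [Real.rpow_def_of_pos hn0]
    apply Real.exp_le_exp.2
    nlinarith
  have h3 := (mul_le_mul_right (measure_mono (μ := μ) h2) (ENNReal.ofReal ((n:ℝ) ^ (2 * c ^ 2)))).trans (h1.trans hM)
  have hp : 0 < (n:ℝ) ^ (2 * c ^ 2) := by positivity
  have hne : ENNReal.ofReal ((n:ℝ) ^ (2 * c ^ 2)) ≠ 0 := by simpa using hp
  rw [mul_comm, ← ENNReal.le_div_iff_mul_le (Or.inl hne) (Or.inl ENNReal.ofReal_ne_top),
    ← ENNReal.ofReal_div_of_pos hp] at h3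
  refine h3.trans (ENNReal.ofReal_le_ofReal (le_of_eq ?_))
  rw [mul_div_assoc, ← Real.rpow_sub hn0]
  congr 2
  have : (2 * c * s) ^ 2 = 4 * c ^ 2 * s ^ 2 := by ring
  rw [this, hs]; ring

lemma tail {c : ℝ} (hc : 0 < c) : ∃ K : ℝ, 0 ≤ K ∧
    ∀ (μ : (n : ℕ) → Measure (Matrix.unitaryGroup (Fin n) ℂ)),
    (∀ n, (μ n).IsHaarMeasure) → (∀ n, IsProbabilityMeasure (μ n)) → ∀ n : ℕ, 1 ≤ n →
    μ n {A | c * Real.log n ≤ |TT (A : Matrix (Fin n) (Fin n) ℂ)|} ≤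
      ENNReal.ofReal (K * (n:ℝ) ^ (-c ^ 2)) := by
  obtain ⟨K1, hK1, h1⟩ := MM_bound (2 * c * 1)
  obtain ⟨K2, hK2, h2⟩ := MM_bound (2 * c * (-1))
  refine ⟨K1 + K2, by positivity, fun μ m1 m2 n hn => ?_⟩
  have t1 := tail_one hn (μ n) hK1 (by norm_num) (h1 μ m1 m2 n hn) hc
  have t2 := tail_one hn (μ n) hK2 (by norm_num) (h2 μ m1 m2 n hn) hc
  rw [add_mul, ENNReal.ofReal_add (by positivity) (by positivity)]
  refine le_trans (measure_mono ?_) ((measure_union_le _ _).trans (add_le_add t1 t2))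
  intro A hA
  have hA' : c * Real.log n ≤ |TT (A : Matrix (Fin n) (Fin n) ℂ)| := hA
  rcases le_abs.1 hA' with h | h
  · left
    show c * Real.log n ≤ 1 * TT (A : Matrix (Fin n) (Fin n) ℂ)
    linarith
  · right
    show c * Real.log n ≤ (-1) * TT (A : Matrix (Fin n) (Fin n) ℂ)
    linarith

lemma abs_SS_eq {n : ℕ} (A : Matrix.unitaryGroup (Fin n) ℂ) (θ : ℝ) :
    |SS (A : Matrix (Fin n) (Fin n) ℂ) θ| =
      |TT ((scal n (Complex.exp ((-θ : ℝ) * I)) (Complex.norm_exp_ofReal_mul_I _) * A :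
        Matrix.unitaryGroup (Fin n) ℂ) : Matrix (Fin n) (Fin n) ℂ)| := by
  rw [SS_eq _ A.2, abs_neg, scal_mul]

lemma measurable_SS {n : ℕ} (θ : ℝ) :
    Measurable fun A : Matrix.unitaryGroup (Fin n) ℂ => |SS (A : Matrix (Fin n) (Fin n) ℂ) θ| := by
  simp_rw [abs_SS_eq]
  exact (measurable_TT.comp (measurable_const_mul _)).norm

/-- the bad event -/
def bad (c : ℝ) (n : ℕ) : Set (Matrix.unitaryGroup (Fin n) ℂ) :=
  ⋃ k ∈ Finset.range (n + 1),
    {A | c * Real.log n ≤ |SS (A : Matrix (Fin n) (Fin n) ℂ) (2 * π * k / n)|}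

lemma measurableSet_bad (c : ℝ) (n : ℕ) : MeasurableSet (bad c n) := by
  apply Finset.measurableSet_biUnion
  intro k _
  exact measurableSet_le measurable_const (measurable_SS _)

lemma bad_le {c : ℝ} (hc : 0 < c) : ∃ K : ℝ, 0 ≤ K ∧
    ∀ (μ : (n : ℕ) → Measure (Matrix.unitaryGroup (Fin n) ℂ)),
    (∀ n, (μ n).IsHaarMeasure) → (∀ n, IsProbabilityMeasure (μ n)) → ∀ n : ℕ, 1 ≤ n →
    μ n (bad c n) ≤ ENNReal.ofReal (K * (n:ℝ) ^ (1 - c ^ 2)) := by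
  obtain ⟨K, hK, h⟩ := tail hc
  refine ⟨2 * K, by positivity, fun μ m1 m2 n hn => ?_⟩
  have hn0 : (1:ℝ) ≤ n := by exact_mod_cast hn
  have := m1 n
  calc μ n (bad c n) ≤ ∑ k ∈ Finset.range (n + 1),
        μ n {A | c * Real.log n ≤ |SS (A : Matrix (Fin n) (Fin n) ℂ) (2 * π * k / n)|} :=
        measure_biUnion_finset_le _ _
    _ ≤ ∑ k ∈ Finset.range (n + 1), ENNReal.ofReal (K * (n:ℝ) ^ (-c ^ 2)) := by
        apply Finset.sum_le_sum
        intro k _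
        refine le_trans (le_of_eq ?_) (h μ m1 m2 n hn)
        rw [← measure_preimage_mul (μ n) (scal n (Complex.exp ((-(2 * π * k / n) : ℝ) * I))
          (Complex.norm_exp_ofReal_mul_I _))
          {A | c * Real.log n ≤ |TT (A : Matrix (Fin n) (Fin n) ℂ)|}]
        congr 1
        ext A
        simp only [Set.mem_ofPred_eq, Set.mem_preimage, abs_SS_eq]
    _ = ENNReal.ofReal ((n + 1) * (K * (n:ℝ) ^ (-c ^ 2))) := by
        rw [Finset.sum_const, Finset.card_range, nsmul_eq_mul,
          ENNReal.ofReal_mul (p := (n:ℝ) + 1) (by positivity)]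
        congr 1
        rw [← ENNReal.ofReal_natCast, Nat.cast_add, Nat.cast_one]
    _ ≤ _ := by
        apply ENNReal.ofReal_le_ofReal
        rw [sub_eq_add_neg, Real.rpow_add (by linarith), Real.rpow_one]
        have : 0 ≤ K * (n:ℝ) ^ (-c ^ 2) := by positivity
        nlinarith

lemma borel_cantelli {Ω : Type*} [MeasureSpace Ω]
    (U : (n : ℕ) → Ω → Matrix.unitaryGroup (Fin n) ℂ)
    (hmeas : ∀ n, Measurable (U n))
    (μ : (n : ℕ) → Measure (Matrix.unitaryGroup (Fin n) ℂ))
    (hHaar : ∀ n, (μ n).IsHaarMeasure) (hprob : ∀ n, IsProbabilityMeasure (μ n))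
    (hlaw : ∀ n, Measure.map (U n) (volume : Measure Ω) = μ n) {c : ℝ} (hc : √2 < c) :
    ∀ᵐ ω ∂(volume : Measure Ω), ∀ᶠ n in atTop, U (n + 1) ω ∉ bad c (n + 1) := by
  have h2 : (0:ℝ) < √2 := by positivity
  have hc0 : 0 < c := h2.trans hc
  obtain ⟨K, hK, h⟩ := bad_le hc0
  apply ae_eventually_notMem (s := fun n => (U (n + 1)) ⁻¹' (bad c (n + 1)))
  have h3 : ∀ n, volume ((U (n + 1)) ⁻¹' (bad c (n + 1))) ≤
      ENNReal.ofReal (K * ((n + 1 : ℕ):ℝ) ^ (1 - c ^ 2)) := by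
    intro n
    rw [← Measure.map_apply (hmeas _) (measurableSet_bad _ _), hlaw]
    exact h μ hHaar hprob (n + 1) (by omega)
  have hs : Summable fun n : ℕ => K * ((n + 1 : ℕ):ℝ) ^ (1 - c ^ 2) := by
    apply Summable.mul_left
    apply (summable_nat_add_iff (f := fun n : ℕ => (n:ℝ) ^ (1 - c ^ 2)) 1).2
    apply Real.summable_nat_rpow.2
    have : (√2 : ℝ) ^ 2 = 2 := Real.sq_sqrt (by norm_num)
    nlinarith
  refine ne_top_of_le_ne_top ?_ (ENNReal.tsum_le_tsum h3)
  exact hs.tsum_ofReal_ne_top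

end ArgMax


theorem limsup_max_argument_le_sqrt_two
    (Ω : Type*) [MeasureSpace Ω] [IsProbabilityMeasure (volume : Measure Ω)]
    (U : (n : ℕ) → Ω → Matrix.unitaryGroup (Fin n) ℂ)
    (hmeas : ∀ n, Measurable (U n))
    (μ : (n : ℕ) → Measure (Matrix.unitaryGroup (Fin n) ℂ))
    (hHaar : ∀ n, (μ n).IsHaarMeasure) (hprob : ∀ n, IsProbabilityMeasure (μ n))
    (hlaw : ∀ n, Measure.map (U n) (volume : Measure Ω) = μ n) :
    ∀ᵐ ω ∂(volume : Measure Ω),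
      Filter.limsup
        (fun n : ℕ => (1 / Real.log n) *
          sSup {v : ℝ | ∃ θ ∈ Set.Ico 0 (2 * π),
            ¬ (Matrix.charpoly ((U n ω : Matrix (Fin n) (Fin n) ℂ))).IsRoot
                (Complex.exp (θ * Complex.I)) ∧
            v = |(Complex.log ((-1) ^ n *
                    Matrix.det ((U n ω : Matrix (Fin n) (Fin n) ℂ)))).im +
                  ((Matrix.charpoly ((U n ω : Matrix (Fin n) (Fin n) ℂ))).roots.map
                    (fun l => (Complex.log (1 - Complex.exp (θ * Complex.I) / l)).im)).sum|})
        Filter.atTop ≤ Real.sqrt 2 := by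
  have hbc : ∀ᵐ ω ∂(volume : Measure Ω), ∀ k : ℕ, ∀ᶠ n in atTop,
      U (n + 1) ω ∉ ArgMax.bad (√2 + 1 / ((k:ℝ) + 1)) (n + 1) := by
    rw [ae_all_iff]
    intro k
    apply ArgMax.borel_cantelli U hmeas μ hHaar hprob hlaw
    have : 0 < 1 / ((k:ℝ) + 1) := by positivity
    linarith
  filter_upwards [hbc] with ω hω
  apply le_of_forall_pos_le_add
  intro ε hε
  obtain ⟨k, hk⟩ := exists_nat_one_div_lt (half_pos hε)
  set c := √2 + 1 / ((k:ℝ) + 1) with hc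
  have hc0 : 0 < c := by positivity
  have hpi := Real.pi_pos
  have hnot : ∀ᶠ n in atTop, U n ω ∉ ArgMax.bad c n := by
    obtain ⟨N, hN⟩ := eventually_atTop.1 (hω k)
    rw [eventually_atTop]
    refine ⟨N + 1, fun n hn => ?_⟩
    obtain ⟨m, rfl⟩ : ∃ m, n = m + 1 := ⟨n - 1, by omega⟩
    exact hN m (by omega)
  have hlog : ∀ᶠ n : ℕ in atTop, 4 * π / ε ≤ Real.log n :=
    (Real.tendsto_log_atTop.comp tendsto_natCast_atTop_atTop).eventually_ge_atTop _
  apply Filter.limsup_le_of_le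
  · apply Filter.isCoboundedUnder_le_of_le atTop (x := 0)
    intro n
    apply mul_nonneg
    · have := Real.log_natCast_nonneg n
      positivity
    · apply Real.sSup_nonneg
      rintro v ⟨θ, _, _, rfl⟩
      exact abs_nonneg _
  · filter_upwards [hnot, hlog, eventually_ge_atTop 2] with n h1 h2 h3
    have hl : 0 < Real.log n := lt_of_lt_of_le (by positivity) h2
    have hgrid : ∀ j ∈ Finset.range (n + 1),
        |ArgMax.SS (U n ω : Matrix (Fin n) (Fin n) ℂ) (2 * π * j / n)| ≤ c * Real.log n := by
      intro j hj
      by_contra hcon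
      push Not at hcon
      apply h1
      exact Set.mem_biUnion hj hcon.le
    have hsup : sSup {v : ℝ | ∃ θ ∈ Set.Ico 0 (2 * π),
            ¬ (Matrix.charpoly ((U n ω : Matrix (Fin n) (Fin n) ℂ))).IsRoot
                (Complex.exp (θ * Complex.I)) ∧
            v = |(Complex.log ((-1) ^ n *
                    Matrix.det ((U n ω : Matrix (Fin n) (Fin n) ℂ)))).im +
                  ((Matrix.charpoly ((U n ω : Matrix (Fin n) (Fin n) ℂ))).roots.map
                    (fun l => (Complex.log (1 - Complex.exp (θ * Complex.I) / l)).im)).sum|} ≤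
          c * Real.log n + 2 * π := by
      apply Real.sSup_le
      · rintro v ⟨θ, hθ, _, rfl⟩
        have g := ArgMax.grid h3 _ (U n ω).2 hgrid hθ
        refine (abs_add_le _ _).trans ?_
        have a : |(Complex.log ((-1) ^ n *
                    Matrix.det ((U n ω : Matrix (Fin n) (Fin n) ℂ)))).im| ≤ π := by
          rw [Complex.log_im]
          exact Complex.abs_arg_le_pi _
        have g' : |((Matrix.charpoly ((U n ω : Matrix (Fin n) (Fin n) ℂ))).roots.map
                    (fun l => (Complex.log (1 - Complex.exp (θ * Complex.I) / l)).im)).sum| ≤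
            c * Real.log n + π := g
        linarith
      · positivity
    calc _ ≤ (1 / Real.log n) * (c * Real.log n + 2 * π) := by gcongr
      _ = c + 2 * π / Real.log n := by field_simp
      _ ≤ √2 + ε := by
        have : 2 * π / Real.log n ≤ ε / 2 := by
          rw [div_le_iff₀ hl]
          rw [div_le_iff₀ hε] at h2
          linarith
        linarith
end

section
/- Let n ≥ 1 and let U be an n×n complex unitary matrix such that 1 is not an eigenvalue, with eigenangles θ_1,…,θ_n ∈ (0, 2π) (listed with multiplicity). Then for every z ∈ ℂ, det(e^{2πiz/n}·I − U) / det(I − U) = e^{iπz} · Π_{k=1}^n [ sin(θ_k/2 − πz/n) / sin(θ_k/2) ], where sin denotes the complex sine function. -/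
open Complex Real Polynomial

lemma exp_sub_exp_aux (a t : ℂ) : Complex.exp (2 * a * Complex.I) - Complex.exp (t * Complex.I) =
    (-2 * Complex.I * Complex.exp (t / 2 * Complex.I)) *
      (Complex.exp (a * Complex.I) * Complex.sin (t / 2 - a)) := by
  have h1 : Complex.exp (2 * a * Complex.I) = Complex.exp (t / 2 * Complex.I) *
      Complex.exp (a * Complex.I) * Complex.exp (-(t / 2 - a) * Complex.I) := by
    rw [← Complex.exp_add, ← Complex.exp_add]; congr 1; ring
  have h2 : Complex.exp (t * Complex.I) = Complex.exp (t / 2 * Complex.I) *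
      Complex.exp (a * Complex.I) * Complex.exp ((t / 2 - a) * Complex.I) := by
    rw [← Complex.exp_add, ← Complex.exp_add]; congr 1; ring
  rw [h1, h2, Complex.sin]
  linear_combination (Complex.exp (t / 2 * Complex.I) * Complex.exp (a * Complex.I) *
    (Complex.exp (-(t / 2 - a) * Complex.I) - Complex.exp ((t / 2 - a) * Complex.I))) *
      Complex.I_mul_I

lemma det_aux (n : ℕ) (U : Matrix (Fin n) (Fin n) ℂ) (θ : Fin n → ℝ)
    (hspec : (Matrix.charpoly U) =
      ∏ k : Fin n, (Polynomial.X - Polynomial.C (Complex.exp (θ k * Complex.I)))) (w : ℂ) :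
    Matrix.det (w • (1 : Matrix (Fin n) (Fin n) ℂ) - U) =
      ∏ k : Fin n, (w - Complex.exp (θ k * Complex.I)) := by
  have h := congrArg (Polynomial.eval w) hspec
  rw [Matrix.eval_charpoly, Polynomial.eval_prod] at h
  rw [Matrix.smul_one_eq_diagonal]
  simpa using h

theorem char_poly_ratio_eq_sine_product (n : ℕ) (hn : 1 ≤ n)
    (U : Matrix (Fin n) (Fin n) ℂ) (hU : U ∈ Matrix.unitaryGroup (Fin n) ℂ)
    (θ : Fin n → ℝ) (hθ : ∀ k, θ k ∈ Set.Ioo 0 (2 * π))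
    (hspec : (Matrix.charpoly U) =
      ∏ k : Fin n, (Polynomial.X - Polynomial.C (Complex.exp (θ k * Complex.I))))
    (z : ℂ) :
    Matrix.det (Complex.exp (2 * π * Complex.I * z / n) • (1 : Matrix (Fin n) (Fin n) ℂ) - U) /
        Matrix.det ((1 : Matrix (Fin n) (Fin n) ℂ) - U) =
      Complex.exp (Complex.I * π * z) *
        ∏ k : Fin n,
          Complex.sin ((θ k : ℂ) / 2 - π * z / n) / Complex.sin ((θ k : ℂ) / 2) := by
  have hn0 : (n : ℂ) ≠ 0 := by exact_mod_cast (by omega : n ≠ 0)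
  have hd1 := det_aux n U θ hspec 1
  rw [one_smul] at hd1
  rw [det_aux n U θ hspec, hd1, ← Finset.prod_div_distrib]
  have hE : Complex.exp (Complex.I * π * z) =
      ∏ _k : Fin n, Complex.exp (π * z / n * Complex.I) := by
    rw [Finset.prod_const, Finset.card_univ, Fintype.card_fin, ← Complex.exp_nat_mul]
    congr 1
    field_simp
  rw [hE, ← Finset.prod_mul_distrib]
  refine Finset.prod_congr rfl fun k _ => ?_
  have h1 := exp_sub_exp_aux (π * z / n) (θ k)
  have h2 := exp_sub_exp_aux 0 (θ k)
  rw [show 2 * (π * z / n) * Complex.I = 2 * π * Complex.I * z / n by ring] at h1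
  simp only [mul_zero, zero_mul, Complex.exp_zero, sub_zero, one_mul] at h2
  rw [h1, h2, mul_div_mul_left, mul_div_assoc]
  simp [Complex.exp_ne_zero, Complex.I_ne_zero]
end

section
/- Let n ≥ 1 and let U be an n×n complex unitary matrix such that 1 is not an eigenvalue, with eigenangles 0 < θ_1 ≤ … ≤ θ_n < 2π. Define the doubly infinite sequence (y_k)_{k∈ℤ} by y_k = n·θ_k/(2π) for 1 ≤ k ≤ n and y_{k+jn} = y_k + jn for all j ∈ ℤ. Then for every z ∈ ℂ, the symmetric limit lim_{B→∞} Π_{−B ≤ k ≤ B} (1 − z/y_k) exists and det(e^{2πiz/n}·I − U) / det(I − U) = e^{iπz} · lim_{B→∞} Π_{−B ≤ k ≤ B} (1 − z/y_k). -/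
open Complex Real Polynomial Filter

lemma aux_sym_prod (g : ℤ → ℂ) (B : ℕ) :
    ∏ k ∈ Finset.Icc (-(B : ℤ)) (B : ℤ), g k =
      (∏ k ∈ Finset.range B, g (k + 1)) * ∏ k ∈ Finset.range (B + 1), g (-(k : ℤ)) := by
  induction B with
  | zero => simp
  | succ B ih =>
    have h : Finset.Icc (-((B + 1 : ℕ) : ℤ)) ((B + 1 : ℕ) : ℤ) =
        insert ((B : ℤ) + 1) (insert (-((B + 1 : ℕ) : ℤ)) (Finset.Icc (-(B : ℤ)) (B : ℤ))) := by
      ext k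
      simp only [Finset.mem_Icc, Finset.mem_insert]
      omega
    rw [h, Finset.prod_insert, Finset.prod_insert, ih,
      Finset.prod_range_succ (fun k : ℕ => g ((k : ℤ) + 1)) B,
      Finset.prod_range_succ (fun k : ℕ => g (-(k : ℤ))) (B + 1)]
    · ring
    · simp only [Finset.mem_Icc]; omega
    · simp only [Finset.mem_Icc, Finset.mem_insert]; omega

lemma aux_block_top (g : ℤ → ℂ) (n q : ℕ) :
    ∏ k ∈ Finset.range (q * n), g (k + 1) =
      ∏ r : Fin n, ∏ j ∈ Finset.range q, g ((r : ℕ) + 1 + (j : ℤ) * n) := by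
  induction q with
  | zero => simp
  | succ q ih =>
    simp_rw [Finset.prod_range_succ _ q]
    rw [Finset.prod_mul_distrib, ← ih, add_mul, one_mul, Finset.prod_range_add,
      Finset.prod_range (n := n)]
    congr 1
    refine Finset.prod_congr rfl fun r _ => ?_
    congr 1
    push_cast
    ring

lemma aux_block_bot (g : ℤ → ℂ) (n q : ℕ) :
    ∏ k ∈ Finset.range (q * n), g (-(k : ℤ)) =
      ∏ r : Fin n, ∏ j ∈ Finset.range q, g ((r : ℕ) + 1 + (-((j : ℤ) + 1)) * n) := by
  induction q with
  | zero => simp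
  | succ q ih =>
    simp_rw [Finset.prod_range_succ _ q]
    rw [Finset.prod_mul_distrib, ← ih, add_mul, one_mul, Finset.prod_range_add,
      ← Finset.prod_range_reflect (fun x => g (-((q * n + x : ℕ) : ℤ))), Finset.prod_range (n := n)]
    congr 1
    refine Finset.prod_congr rfl fun r _ => ?_
    congr 1
    have := r.2
    have h : ((n - 1 - (r : ℕ) : ℕ) : ℤ) = n - 1 - (r : ℕ) := by omega
    push_cast [h]
    ring

lemma aux_factor_top (a w : ℂ) : Tendsto (fun q : ℕ => 1 - w / (a + q)) atTop (nhds 1) := by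
  have h : Tendsto (fun q : ℕ => w / (a + q)) atTop (nhds 0) := by
    have h1 : Tendsto (fun q : ℕ => a + (q : ℂ)) atTop (Bornology.cobounded ℂ) :=
      (tendsto_const_add_cobounded a).comp tendsto_natCast_atTop_cobounded
    simpa [div_eq_mul_inv] using (tendsto_inv₀_cobounded.comp h1).const_mul w
  simpa using h.const_sub 1

lemma aux_factor_bot (a w : ℂ) : Tendsto (fun q : ℕ => 1 - w / (a - q)) atTop (nhds 1) := by
  refine (aux_factor_top (-a) (-w)).congr fun q => ?_
  rw [show -a + (q : ℂ) = -(a - q) by ring, neg_div_neg_eq]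

lemma aux_one (a : ℝ) (ha : a ∈ Set.Ioo (0 : ℝ) 1) (w : ℂ) :
    Tendsto (fun q : ℕ => (∏ j ∈ Finset.range q, (1 - w / ((a : ℂ) + j))) *
      ∏ j ∈ Finset.range q, (1 - w / ((a : ℂ) - (j + 1)))) atTop
      (nhds (Complex.sin (π * (a - w)) / Complex.sin (π * a))) := by
  have hpos : ∀ j : ℕ, (a : ℂ) + j ≠ 0 := fun j => by
    have : (0 : ℝ) < a + j := by have := ha.1; positivity
    exact_mod_cast this.ne'
  have hneg : ∀ j : ℕ, (a : ℂ) - (j + 1) ≠ 0 := fun j => by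
    have : a - (j + 1) < 0 := by
      have := ha.2
      have : (0 : ℝ) ≤ j := by positivity
      linarith
    exact_mod_cast this.ne
  have ha0 : (a : ℂ) ≠ 0 := by simpa using hpos 0
  have hsin : Complex.sin (π * a) ≠ 0 := by
    have : 0 < Real.sin (π * a) := Real.sin_pos_of_pos_of_lt_pi
      (mul_pos Real.pi_pos ha.1) (by nlinarith [Real.pi_pos, ha.2])
    exact_mod_cast this.ne'
  have hE := ((tendsto_euler_sin_prod (a - w)).div (tendsto_euler_sin_prod a) hsin)
  rw [← tendsto_add_atTop_iff_nat 1]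
  have hb := (aux_factor_bot (a - 1) w)
  have := hE.mul hb
  rw [mul_one] at this
  refine this.congr fun q => ?_
  simp only [Pi.div_apply]
  have hpi : (π : ℂ) ≠ 0 := by exact_mod_cast Real.pi_ne_zero
  rw [Finset.prod_range_succ' _ q, Finset.prod_range_succ _ q, mul_div_mul_comm,
    ← Finset.prod_div_distrib]
  have key : ∀ j : ℕ, (1 - ((a : ℂ) - w) ^ 2 / ((j : ℂ) + 1) ^ 2) / (1 - (a : ℂ) ^ 2 / ((j : ℂ) + 1) ^ 2) =
      (1 - w / ((a : ℂ) + ((j + 1 : ℕ) : ℂ))) * (1 - w / ((a : ℂ) - (j + 1))) := by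
    intro j
    have h1 := hpos (j + 1)
    have h2 := hneg j
    have h3 : (j : ℂ) + 1 ≠ 0 := by exact_mod_cast Nat.succ_ne_zero j
    push_cast at h1 ⊢
    have h4 : (1 - (a : ℂ) ^ 2 / ((j : ℂ) + 1) ^ 2) =
      - (((a : ℂ) + (j + 1)) * ((a : ℂ) - (j + 1))) / ((j : ℂ) + 1) ^ 2 := by
      field_simp; ring
    have h5 : (1 - ((a : ℂ) - w) ^ 2 / ((j : ℂ) + 1) ^ 2) =
      - (((a : ℂ) + (j + 1) - w) * ((a : ℂ) - (j + 1) - w)) / ((j : ℂ) + 1) ^ 2 := by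
      field_simp; ring
    have h6 : 1 - w / ((a : ℂ) + (j + 1)) = ((a : ℂ) + (j + 1) - w) / ((a : ℂ) + (j + 1)) := by
      rw [sub_div _ w, div_self h1]
    have h7 : 1 - w / ((a : ℂ) - (j + 1)) = ((a : ℂ) - (j + 1) - w) / ((a : ℂ) - (j + 1)) := by
      rw [sub_div _ w, div_self h2]
    rw [h4, h5, h6, h7, div_div_div_cancel_right₀ (pow_ne_zero 2 h3), neg_div_neg_eq,
      mul_div_mul_comm]
  rw [Finset.prod_congr rfl fun j _ => key j, Finset.prod_mul_distrib]
  have h0 : (π * ((a : ℂ) - w)) / (π * a) = 1 - w / ((a : ℂ) + ((0 : ℕ) : ℂ)) := by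
    rw [mul_div_mul_left _ _ hpi, sub_div, div_self ha0]; simp
  rw [h0, show (a : ℂ) - 1 - q = a - (q + 1) by ring]
  ring

lemma aux_residue (F : ℕ → ℂ) (L : ℂ) (n : ℕ) (hn : 1 ≤ n)
    (h : ∀ s : Fin n, Tendsto (fun q : ℕ => F (q * n + s)) atTop (nhds L)) :
    Tendsto F atTop (nhds L) := by
  rw [tendsto_def]
  intro S hS
  have h1 : ∀ᶠ q : ℕ in atTop, ∀ s : Fin n, F (q * n + s) ∈ S :=
    eventually_all.2 fun s => (h s).eventually hS
  have h2 : Tendsto (fun B : ℕ => B / n) atTop atTop := Nat.tendsto_div_const_atTop (by omega)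
  filter_upwards [h2.eventually h1] with B hB
  have := hB ⟨B % n, Nat.mod_lt _ (by omega)⟩
  simpa [Nat.div_add_mod'] using this

lemma aux_trig (a : ℝ) (ha : a ∈ Set.Ioo (0 : ℝ) 1) (w : ℂ) :
    (Complex.exp (2 * π * I * w) - Complex.exp (2 * π * I * a)) /
      (1 - Complex.exp (2 * π * I * a)) =
    Complex.exp (I * π * w) * (Complex.sin (π * (a - w)) / Complex.sin (π * a)) := by
  have hsin : Complex.sin (π * a) ≠ 0 := by
    have : 0 < Real.sin (π * a) := Real.sin_pos_of_pos_of_lt_pi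
      (mul_pos Real.pi_pos ha.1) (by nlinarith [Real.pi_pos, ha.2])
    exact_mod_cast this.ne'
  have gen : ∀ u : ℂ, Complex.exp (2 * π * I * u) - Complex.exp (2 * π * I * a) =
      (-2 * I * Complex.exp (I * π * a)) * (Complex.exp (I * π * u) * Complex.sin (π * (a - u))) := by
    intro u
    have e1 : Complex.exp (2 * π * I * u) = Complex.exp (I * π * u) * Complex.exp (I * π * u) := by
      rw [← Complex.exp_add]; congr 1; ring
    have e2 : Complex.exp (2 * π * I * a) = Complex.exp (I * π * a) * Complex.exp (I * π * a) := by
      rw [← Complex.exp_add]; congr 1; ring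
    have e3 : Complex.exp (-(π * (a - u)) * I) =
        Complex.exp (I * π * u) * (Complex.exp (I * π * a))⁻¹ := by
      rw [← Complex.exp_neg, ← Complex.exp_add]; congr 1; ring
    have e4 : Complex.exp ((π * (a - u)) * I) =
        Complex.exp (I * π * a) * (Complex.exp (I * π * u))⁻¹ := by
      rw [← Complex.exp_neg, ← Complex.exp_add]; congr 1; ring
    rw [Complex.sin, e3, e4, e1, e2]
    have := Complex.exp_ne_zero (I * π * a)
    have := Complex.exp_ne_zero (I * π * u)
    field_simp
    rw [I_sq]
    ring
  have g0 := gen 0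
  simp only [mul_zero, Complex.exp_zero, sub_zero, one_mul] at g0
  rw [gen w, g0, mul_div_mul_left, mul_div_assoc]
  simp [Complex.exp_ne_zero]

theorem char_poly_ratio_eq_symmetric_product (n : ℕ) (hn : 1 ≤ n)
    (U : Matrix (Fin n) (Fin n) ℂ) (hU : U ∈ Matrix.unitaryGroup (Fin n) ℂ)
    (θ : Fin n → ℝ) (hθmono : Monotone θ) (hθ : ∀ k, θ k ∈ Set.Ioo 0 (2 * π))
    (hspec : (Matrix.charpoly U) =
      ∏ k : Fin n, (Polynomial.X - Polynomial.C (Complex.exp (θ k * Complex.I))))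
    (y : ℤ → ℝ)
    (hy : ∀ k : Fin n, y ((k : ℕ) + 1) = n * θ k / (2 * π))
    (hyper : ∀ k j : ℤ, y (k + j * n) = y k + j * n)
    (z : ℂ) :
    ∃ L : ℂ,
      Filter.Tendsto
        (fun B : ℕ => ∏ k ∈ Finset.Icc (-(B : ℤ)) (B : ℤ), (1 - z / (y k : ℂ)))
        Filter.atTop (nhds L) ∧
      Matrix.det (Complex.exp (2 * π * Complex.I * z / n) • (1 : Matrix (Fin n) (Fin n) ℂ) - U) /
          Matrix.det ((1 : Matrix (Fin n) (Fin n) ℂ) - U) =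
        Complex.exp (Complex.I * π * z) * L := by
  have hn0 : (n : ℂ) ≠ 0 := by exact_mod_cast (by omega : n ≠ 0)
  have hpi : (π : ℂ) ≠ 0 := by exact_mod_cast Real.pi_ne_zero
  set w : ℂ := z / n with hw
  set a : Fin n → ℝ := fun r => θ r / (2 * π) with ha_def
  have ha : ∀ r, a r ∈ Set.Ioo (0 : ℝ) 1 := fun r => by
    have h2 : 0 < 2 * π := by positivity
    exact ⟨div_pos (hθ r).1 h2, (div_lt_one h2).2 (hθ r).2⟩
  set g : ℤ → ℂ := fun k => 1 - z / (y k : ℂ) with hg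
  have hgv : ∀ (r : Fin n) (j : ℤ), g ((r : ℕ) + 1 + j * n) = 1 - w / ((a r : ℂ) + j) := by
    intro r j
    have : ((y ((r : ℕ) + 1 + j * n) : ℝ) : ℂ) = n * ((a r : ℂ) + j) := by
      rw [hyper, hy]
      simp only [ha_def]
      push_cast
      ring
    simp only [hg, this, hw]
    rw [div_div]
  -- factors along arithmetic progressions tend to one
  have hgt : ∀ c : ℤ, Tendsto (fun q : ℕ => g (c + (q : ℤ) * n)) atTop (nhds 1) := by
    intro c
    refine (aux_factor_top ((y c : ℂ) / n) w).congr fun q => ?_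
    simp only [hg, hyper, hw]
    rw [div_div]
    congr 2
    push_cast
    field_simp
  have hgb : ∀ c : ℤ, Tendsto (fun q : ℕ => g (c + (-(q : ℤ)) * n)) atTop (nhds 1) := by
    intro c
    refine (aux_factor_bot ((y c : ℂ) / n) w).congr fun q => ?_
    simp only [hg, hyper, hw]
    rw [div_div]
    congr 2
    push_cast
    field_simp
    try ring
  refine ⟨∏ r : Fin n, (Complex.sin (π * (a r - w)) / Complex.sin (π * a r)), ?_, ?_⟩
  · refine aux_residue _ _ n hn fun s => ?_
    have hbase : Tendsto (fun q : ℕ => ∏ r : Fin n,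
        ((∏ j ∈ Finset.range q, (1 - w / ((a r : ℂ) + j))) *
        ∏ j ∈ Finset.range q, (1 - w / ((a r : ℂ) - (j + 1))))) atTop
        (nhds (∏ r : Fin n, (Complex.sin (π * (a r - w)) / Complex.sin (π * a r)))) :=
      tendsto_finsetProd _ fun r _ => aux_one (a r) (ha r) w
    have ht : Tendsto (fun q : ℕ => ∏ i ∈ Finset.range (s : ℕ), g ((i : ℤ) + 1 + (q : ℤ) * n))
        atTop (nhds 1) := by
      simpa using tendsto_finsetProd (Finset.range (s : ℕ)) fun i _ => hgt ((i : ℤ) + 1)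
    have hb : Tendsto (fun q : ℕ => ∏ i ∈ Finset.range ((s : ℕ) + 1),
        g (-(i : ℤ) + (-(q : ℤ)) * n)) atTop (nhds 1) := by
      simpa using tendsto_finsetProd (Finset.range ((s : ℕ) + 1)) fun i _ => hgb (-(i : ℤ))
    have := (hbase.mul ht).mul hb
    rw [mul_one, mul_one] at this
    refine this.congr fun q => ?_
    change _ = ∏ k ∈ Finset.Icc (-((q * n + s : ℕ) : ℤ)) ((q * n + s : ℕ) : ℤ), g k
    rw [aux_sym_prod, Finset.prod_range_add (fun k : ℕ => g ((k : ℤ) + 1)) (q * n), add_assoc (q * n),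
      Finset.prod_range_add (fun k : ℕ => g (-(k : ℤ))) (q * n),
      aux_block_top, aux_block_bot, Finset.prod_mul_distrib]
    simp_rw [hgv]
    have e1 : ∀ i : ℕ, g (((q * n + i : ℕ) : ℤ) + 1) = g ((i : ℤ) + 1 + (q : ℤ) * n) := by
      intro i; congr 1; push_cast; ring
    have e2 : ∀ i : ℕ, g (-((q * n + i : ℕ) : ℤ)) = g (-(i : ℤ) + (-(q : ℤ)) * n) := by
      intro i; congr 1; push_cast; ring
    simp_rw [e1, e2]
    push_cast
    simp_rw [← sub_eq_add_neg]
    ring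
  · have hdet : ∀ t : ℂ, Matrix.det (t • (1 : Matrix (Fin n) (Fin n) ℂ) - U) =
        ∏ r : Fin n, (t - Complex.exp (2 * π * I * a r)) := by
      intro t
      have h1 := Matrix.eval_charpoly U t
      rw [hspec, Polynomial.eval_prod] at h1
      rw [Matrix.scalar_apply, ← Matrix.smul_one_eq_diagonal] at h1
      rw [← h1]
      refine Finset.prod_congr rfl fun r _ => ?_
      simp only [Polynomial.eval_sub, Polynomial.eval_X, Polynomial.eval_C, ha_def]
      congr 2
      push_cast
      field_simp
    have h1 := hdet 1
    rw [one_smul] at h1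
    rw [hdet, h1, ← Finset.prod_div_distrib]
    have e : Complex.exp (I * π * z) = ∏ _r : Fin n, Complex.exp (I * π * w) := by
      rw [Finset.prod_const, Finset.card_univ, Fintype.card_fin, ← Complex.exp_nat_mul]
      congr 1
      rw [hw]
      field_simp
    rw [e, ← Finset.prod_mul_distrib]
    refine Finset.prod_congr rfl fun r _ => ?_
    rw [← aux_trig (a r) (ha r) w, hw, mul_div_assoc]
end

section
/- Let (y_k^{(n)})_{k∈ℤ, n≥1} and (y_k)_{k∈ℤ} be nonzero real numbers, and M > 0 a constant, such that: (i) |y_k^{(n)} − k| ≤ M·log(2 + |k|) for all n ≥ 1 and all k ∈ ℤ; (ii) |y_k − k| ≤ M·log(2 + |k|) for all k ∈ ℤ; (iii) for each k ∈ ℤ, y_k^{(n)} → y_k as n → ∞. Define F_n(z) = e^{iπz} · lim_{B→∞} Π_{−B ≤ k ≤ B}(1 − z/y_k^{(n)}) and F(z) = e^{iπz} · lim_{B→∞} Π_{−B ≤ k ≤ B}(1 − z/y_k) (these symmetric limits exist for every z ∈ ℂ). Then F_n converges to F uniformly on every compact subset of ℂ. -/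
open Complex Real Filter

lemma aux_summable (R : ℝ) : Summable (fun j : ℕ =>
    8 * R * (√((j : ℝ) + 1) / ((j : ℝ) + 1) ^ 2) + 4 * R ^ 2 * (1 / ((j : ℝ) + 1) ^ 2)) := by
  have h1 : Summable (fun j : ℕ => √((j : ℝ) + 1) / ((j : ℝ) + 1) ^ 2) := by
    have h := (summable_nat_add_iff 1).2
      (Real.summable_nat_rpow (p := -(3 / 2 : ℝ)).2 (by norm_num))
    refine h.congr fun j => ?_
    have hx : (0 : ℝ) < (j : ℝ) + 1 := by positivity
    push_cast
    rw [Real.sqrt_eq_rpow, ← Real.rpow_natCast, ← Real.rpow_sub hx]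
    norm_num
  have h2 : Summable (fun j : ℕ => 1 / ((j : ℝ) + 1) ^ 2) := by
    have h := (summable_nat_add_iff 1).2 (Real.summable_one_div_nat_pow (p := 2).2 (by norm_num))
    refine h.congr fun j => ?_
    push_cast
    rfl
  exact (h1.mul_left _).add (h2.mul_left _)

lemma aux_log (M : ℝ) (hM : 0 < M) : ∀ᶠ j : ℕ in atTop,
    M * Real.log (2 + ((j : ℝ) + 1)) ≤ √((j : ℝ) + 1) ∧ (4 : ℝ) ≤ (j : ℝ) + 1 := by
  have h := (isLittleO_log_rpow_atTop (r := 1 / 2) (by norm_num)).def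
    (c := 1 / (2 * M)) (by positivity)
  have ht : Tendsto (fun j : ℕ => 2 + ((j : ℝ) + 1)) atTop atTop :=
    tendsto_atTop_add_const_left _ _
      (tendsto_atTop_add_const_right _ _ tendsto_natCast_atTop_atTop)
  filter_upwards [ht.eventually h, eventually_ge_atTop 3] with j hj hj3
  have h3 : (3 : ℝ) ≤ j := by exact_mod_cast hj3
  refine ⟨?_, by linarith⟩
  rw [← Real.sqrt_eq_rpow, Real.norm_of_nonneg (Real.sqrt_nonneg _)] at hj
  have h4 : √(2 + ((j : ℝ) + 1)) ≤ 2 * √((j : ℝ) + 1) := by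
    rw [show (2 : ℝ) = √4 by rw [show (4 : ℝ) = 2 ^ 2 by norm_num]; simp,
      ← Real.sqrt_mul (by norm_num)]
    apply Real.sqrt_le_sqrt
    have : √(4 : ℝ) = 2 := by rw [show (4 : ℝ) = 2 ^ 2 by norm_num]; simp
    rw [this]
    linarith
  have h5 := le_trans (Real.le_norm_self _) hj
  calc M * Real.log (2 + ((j : ℝ) + 1))
      ≤ M * (1 / (2 * M) * (2 * √((j : ℝ) + 1))) := by
        gcongr
        exact h5.trans (by gcongr)
    _ = √((j : ℝ) + 1) := by field_simp

lemma aux_bound (R x a b : ℝ) (z : ℂ) (hz : ‖z‖ ≤ R) (hx : 4 ≤ x)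
    (ha : |a - x| ≤ √x) (hb : |b + x| ≤ √x) :
    ‖(1 - z / (a : ℂ)) * (1 - z / (b : ℂ)) - 1‖
      ≤ 8 * R * (√x / x ^ 2) + 4 * R ^ 2 * (1 / x ^ 2) := by
  have hs : √x ≤ x / 2 := by
    rw [Real.sqrt_le_left (by linarith)]
    nlinarith
  have hs0 := Real.sqrt_nonneg x
  have hR : 0 ≤ R := (norm_nonneg z).trans hz
  rw [abs_le] at ha hb
  have ha1 : x / 2 ≤ a := by linarith
  have hb1 : x / 2 ≤ -b := by linarith
  have ha0 : a ≠ 0 := by linarith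
  have hb0 : b ≠ 0 := by linarith
  have hac : (a : ℂ) ≠ 0 := by exact_mod_cast ha0
  have hbc : (b : ℂ) ≠ 0 := by exact_mod_cast hb0
  have hab : x ^ 2 / 4 ≤ |a * b| := by
    rw [abs_of_nonpos (by nlinarith)]
    nlinarith
  have e : (1 - z / (a : ℂ)) * (1 - z / (b : ℂ)) - 1
      = (z ^ 2 - z * ((a + b : ℝ) : ℂ)) / ((a * b : ℝ) : ℂ) := by
    push_cast
    field_simp
    ring
  have hsum : |a + b| ≤ 2 * √x := by
    rw [abs_le]
    constructor <;> linarith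
  rw [e, norm_div, Complex.norm_real, Real.norm_eq_abs]
  have hnum : ‖z ^ 2 - z * ((a + b : ℝ) : ℂ)‖ ≤ R ^ 2 + R * (2 * √x) := by
    refine (norm_sub_le _ _).trans ?_
    rw [norm_pow, norm_mul, Complex.norm_real, Real.norm_eq_abs]
    gcongr
  calc _ ≤ (R ^ 2 + R * (2 * √x)) / (x ^ 2 / 4) := by gcongr
    _ = _ := by
      have : x ≠ 0 := by linarith
      field_simp
      ring

lemma aux_prod (g : ℤ → ℂ) (B : ℕ) : ∏ k ∈ Finset.Icc (-(B : ℤ)) (B : ℤ), g k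
    = g 0 * ∏ j ∈ Finset.range B, (1 + (g ((j : ℤ) + 1) * g (-((j : ℤ) + 1)) - 1)) := by
  induction B with
  | zero => simp
  | succ N ih =>
    rw [Nat.cast_add, Nat.cast_one, Finset.Icc_succ_succ, Finset.prod_union (by simp),
      Finset.prod_pair (by lia), ih, Finset.prod_range_succ]
    ring

/-- The infinite product as a function of the zeros and of the variable. -/
noncomputable def auxF (w : ℤ → ℝ) (z : ℂ) : ℂ :=
  Complex.exp (Complex.I * π * z) * ((1 - z / (w 0 : ℂ)) *
    ∏' j : ℕ, (1 + ((1 - z / (w ((j : ℤ) + 1) : ℂ)) * (1 - z / (w (-((j : ℤ) + 1)) : ℂ)) - 1)))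

lemma aux_main (S : Set (ℤ → ℝ)) (hS : IsCompact S) (K : Set ℂ) (hK : IsCompact K)
    (M : ℝ) (hM : 0 < M) (h0 : ∀ w ∈ S, ∀ k, w k ≠ 0)
    (hb : ∀ w ∈ S, ∀ k : ℤ, |w k - k| ≤ M * Real.log (2 + |(k : ℝ)|)) :
    ContinuousOn (Function.uncurry auxF) (S ×ˢ K) ∧
    ∀ w ∈ S, ∀ z ∈ K, Tendsto (fun B : ℕ => Complex.exp (Complex.I * π * z) *
            ∏ k ∈ Finset.Icc (-(B : ℤ)) (B : ℤ), (1 - z / (w k : ℂ)))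
          atTop (nhds (auxF w z)) := by
  obtain ⟨R, hR⟩ := hK.isBounded.exists_norm_le
  have hc : ∀ k : ℤ, ContinuousOn (fun p : (ℤ → ℝ) × ℂ => 1 - p.2 / (p.1 k : ℂ)) (S ×ˢ K) := by
    intro k
    refine continuousOn_const.sub (continuousOn_snd.div ?_ ?_)
    · exact Continuous.continuousOn (by fun_prop)
    · intro p hp
      exact_mod_cast h0 _ hp.1 k
  have hU := Summable.hasProdUniformlyOn_nat_one_add
    (f := fun (j : ℕ) (p : (ℤ → ℝ) × ℂ) =>
      (1 - p.2 / (p.1 ((j : ℤ) + 1) : ℂ)) * (1 - p.2 / (p.1 (-((j : ℤ) + 1)) : ℂ)) - 1)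
    (hS.prod hK) (aux_summable R) (by
      filter_upwards [aux_log M hM] with j hj p hp
      refine aux_bound R _ _ _ _ (hR _ hp.2) hj.2 ?_ ?_
      · have := hb _ hp.1 ((j : ℤ) + 1)
        push_cast at this
        rw [abs_of_nonneg (by positivity : (0 : ℝ) ≤ (j : ℝ) + 1)] at this
        exact this.trans hj.1
      · have := hb _ hp.1 (-((j : ℤ) + 1))
        push_cast at this
        rw [abs_neg, abs_of_nonneg (by positivity : (0 : ℝ) ≤ (j : ℝ) + 1), sub_neg_eq_add] at this
        exact this.trans hj.1)
    (fun j => ((hc _).mul (hc _)).sub continuousOn_const)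
  have hT := hU.tendstoUniformlyOn_finsetRange
  refine ⟨?_, ?_⟩
  · have h1 := hT.continuousOn (Frequently.of_forall fun n =>
      continuousOn_finsetProd _ fun j _ =>
        continuousOn_const.add (((hc _).mul (hc _)).sub continuousOn_const))
    have h2 : ContinuousOn (fun p : (ℤ → ℝ) × ℂ => Complex.exp (Complex.I * π * p.2))
        (S ×ˢ K) := Continuous.continuousOn (by fun_prop)
    exact h2.mul ((hc 0).mul h1)
  · intro w hw z hz
    have h := hT.tendsto_at (x := (w, z)) ⟨hw, hz⟩
    refine ((h.const_mul (1 - z / (w 0 : ℂ))).const_mul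
      (Complex.exp (Complex.I * π * z))).congr fun B => ?_
    rw [aux_prod (fun k => 1 - z / (w k : ℂ))]



theorem uniform_convergence_of_rescaled_char_poly
    (y' : ℕ → ℤ → ℝ) (y : ℤ → ℝ)
    (hy'0 : ∀ n k, y' n k ≠ 0) (hy0 : ∀ k, y k ≠ 0)
    (M : ℝ) (hM : 0 < M)
    (hbound' : ∀ n : ℕ, ∀ k : ℤ, |y' n k - k| ≤ M * Real.log (2 + |(k : ℝ)|))
    (hbound : ∀ k : ℤ, |y k - k| ≤ M * Real.log (2 + |(k : ℝ)|))
    (hconv : ∀ k : ℤ, Filter.Tendsto (fun n : ℕ => y' n k) Filter.atTop (nhds (y k))) :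
    ∃ Fn : ℕ → ℂ → ℂ, ∃ F : ℂ → ℂ,
      (∀ n : ℕ, ∀ z : ℂ,
        Filter.Tendsto
          (fun B : ℕ => Complex.exp (Complex.I * π * z) *
            ∏ k ∈ Finset.Icc (-(B : ℤ)) (B : ℤ), (1 - z / (y' n k : ℂ)))
          Filter.atTop (nhds (Fn n z))) ∧
      (∀ z : ℂ,
        Filter.Tendsto
          (fun B : ℕ => Complex.exp (Complex.I * π * z) *
            ∏ k ∈ Finset.Icc (-(B : ℤ)) (B : ℤ), (1 - z / (y k : ℂ)))
          Filter.atTop (nhds (F z))) ∧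
      (∀ K : Set ℂ, IsCompact K → TendstoUniformlyOn Fn F Filter.atTop K) := by
  have hT : Tendsto y' atTop (nhds y) := tendsto_pi_nhds.2 hconv
  have hS := hT.isCompact_insert_range
  have h0 : ∀ w ∈ insert y (Set.range y'), ∀ k, w k ≠ 0 := by
    rintro w (rfl | ⟨n, rfl⟩)
    · exact hy0
    · exact hy'0 n
  have hb : ∀ w ∈ insert y (Set.range y'), ∀ k : ℤ,
      |w k - k| ≤ M * Real.log (2 + |(k : ℝ)|) := by
    rintro w (rfl | ⟨n, rfl⟩)
    · exact hbound
    · exact hbound' n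
  have hm : ∀ n, y' n ∈ insert y (Set.range y') := fun n => Or.inr ⟨n, rfl⟩
  refine ⟨fun n => auxF (y' n), auxF y, fun n z => ?_, fun z => ?_, fun K hK => ?_⟩
  · exact (aux_main _ hS {z} isCompact_singleton M hM h0 hb).2 _ (hm n) z rfl
  · exact (aux_main _ hS {z} isCompact_singleton M hM h0 hb).2 _ (Or.inl rfl) z rfl
  · intro u hu
    obtain ⟨v, hv, hvu⟩ := hK.mem_uniformity_of_prod (aux_main _ hS K hK M hM h0 hb).1
      (Or.inl rfl : y ∈ insert y (Set.range y')) (symm_le_uniformity hu)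
    have ht : Tendsto y' atTop (nhdsWithin y (insert y (Set.range y'))) :=
      tendsto_nhdsWithin_iff.2 ⟨hT, Eventually.of_forall hm⟩
    filter_upwards [ht hv] with n hn z hz
    exact hvu _ hn z hz
end

section
/- For each integer α ≥ 0, define the rational functions g_m by g_0(w) = (w+1)/(w−1) and g_{m+1}(w) = w·g_m'(w). Then for every integer α ≥ 1 and every real number x with x ∉ 2πℤ, the series Σ_{k∈ℤ} 1/(x + 2πk)^{α+1} converges absolutely and equals (i^{α+1}/2)·((−1)^α/α!)·g_α(e^{ix}). -/
open Complex Real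

lemma aux_g_diff (g : ℕ → ℂ → ℂ)
    (hg0 : ∀ w : ℂ, g 0 w = (w + 1) / (w - 1))
    (hgs : ∀ m : ℕ, ∀ w : ℂ, g (m + 1) w = w * deriv (g m) w) (n : ℕ) :
    DifferentiableOn ℂ (g n) {1}ᶜ := by
  induction n with
  | zero =>
    have : g 0 = fun w => (w + 1) / (w - 1) := funext hg0
    rw [this]
    intro w hw
    have : w - 1 ≠ 0 := sub_ne_zero.mpr hw
    exact DifferentiableAt.differentiableWithinAt (by fun_prop (disch := assumption))
  | succ n ih =>
    have : g (n + 1) = fun w => w * deriv (g n) w := funext (hgs n)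
    rw [this]
    exact differentiableOn_id.mul (ih.deriv isOpen_compl_singleton)

lemma aux_exp_ne {z : ℂ} (hz : z ∈ UpperHalfPlane.upperHalfPlaneSet) :
    Complex.exp (2 * π * I * z) ≠ 1 := by
  intro h
  have h2 : ‖Complex.exp (2 * π * I * z)‖ = 1 := by rw [h]; simp
  rw [Complex.norm_exp] at h2
  have hz' : 0 < z.im := hz
  have : (2 * π * I * z).re = - (2 * π * z.im) := by simp
  rw [this, Real.exp_eq_one_iff] at h2
  have := Real.pi_pos
  have : 0 < 2 * π * z.im := by positivity
  linarith

lemma aux_iter (g : ℕ → ℂ → ℂ)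
    (hg0 : ∀ w : ℂ, g 0 w = (w + 1) / (w - 1))
    (hgs : ∀ m : ℕ, ∀ w : ℂ, g (m + 1) w = w * deriv (g m) w) (n : ℕ) :
    ∀ z ∈ UpperHalfPlane.upperHalfPlaneSet,
    iteratedDerivWithin n (fun x : ℂ ↦ π * Complex.cot (π * x))
      UpperHalfPlane.upperHalfPlaneSet z
      = π * I * (2 * π * I) ^ n * g n (Complex.exp (2 * π * I * z)) := by
  induction n with
  | zero =>
    intro z hz
    have h1 : Complex.exp (2 * π * I * z) - 1 ≠ 0 := sub_ne_zero.mpr (aux_exp_ne hz)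
    have h2 : 1 - Complex.exp (2 * π * I * z) ≠ 0 := sub_ne_zero.mpr (aux_exp_ne hz).symm
    simp only [iteratedDerivWithin_zero]
    rw [Complex.cot_pi_eq_exp_ratio, hg0]
    generalize Complex.exp (2 * π * I * z) = e at *
    have hI := Complex.I_ne_zero
    field_simp
    rw [Complex.I_sq]; ring
  | succ n ih =>
    intro z hz
    have ho : IsOpen UpperHalfPlane.upperHalfPlaneSet := UpperHalfPlane.isOpen_upperHalfPlaneSet
    rw [iteratedDerivWithin_succ, derivWithin_congr ih (ih z hz), derivWithin_of_isOpen ho hz]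
    have hd : HasDerivAt (g n) (deriv (g n) (Complex.exp (2 * π * I * z)))
        (Complex.exp (2 * π * I * z)) :=
      ((aux_g_diff g hg0 hgs n).differentiableAt
        (isOpen_compl_singleton.mem_nhds (aux_exp_ne hz))).hasDerivAt
    have he : HasDerivAt (fun z : ℂ => Complex.exp (2 * π * I * z))
        (Complex.exp (2 * π * I * z) * (2 * π * I * 1)) z :=
      ((hasDerivAt_id z).const_mul (2 * π * I)).cexp
    have := ((hd.comp z he).const_mul (π * I * (2 * π * I) ^ n)).deriv
    simp only [Function.comp_def] at this
    rw [this, hgs]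
    ring

lemma aux_upper (g : ℕ → ℂ → ℂ)
    (hg0 : ∀ w : ℂ, g 0 w = (w + 1) / (w - 1))
    (hgs : ∀ m : ℕ, ∀ w : ℂ, g (m + 1) w = w * deriv (g m) w) (α : ℕ) (hα : 1 ≤ α)
    (z : ℂ) (hz : 0 < z.im) :
    (∑' k : ℤ, (1 : ℂ) / ((z + 2 * π * k) ^ (α + 1))) =
      Complex.I ^ (α + 1) / 2 * ((-1) ^ α / (α.factorial : ℂ)) *
        g α (Complex.exp (z * Complex.I)) := by
  have hpi : (π : ℂ) ≠ 0 := by exact_mod_cast Real.pi_ne_zero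
  have hz' : z / (2 * π) ∈ UpperHalfPlane.upperHalfPlaneSet := by
    change 0 < (z / (2 * π)).im
    have : z / (2 * π) = z / ((2 * π : ℝ) : ℂ) := by push_cast; rfl
    rw [this, Complex.div_ofReal_im]
    have := Real.pi_pos
    positivity
  have h1 := iteratedDerivWithin_cot_pi_mul_eq_mul_tsum_div_pow hα hz'
  rw [aux_iter g hg0 hgs α _ hz'] at h1
  have e1 : 2 * π * I * (z / (2 * π)) = z * I := by field_simp
  rw [e1] at h1
  have e2 : ∀ k : ℤ, (1 : ℂ) / ((z + 2 * π * k) ^ (α + 1)) =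
      (1 / (2 * π) ^ (α + 1)) * (1 / (z / (2 * π) + k) ^ (α + 1)) := by
    intro k
    rw [one_div_mul_one_div, ← mul_pow]
    congr 2
    field_simp
  simp_rw [e2]
  rw [tsum_mul_left]
  have hf : (α.factorial : ℂ) ≠ 0 := by exact_mod_cast α.factorial_ne_zero
  have hs : ((-1 : ℂ) ^ α) * (-1) ^ α = 1 := by rw [← mul_pow]; simp
  have h3 : (∑' k : ℤ, 1 / (z / (2 * π) + k) ^ (α + 1)) =
      (-1) ^ α / (α.factorial : ℂ) * (π * I * (2 * π * I) ^ α * g α (Complex.exp (z * I))) := by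
    rw [h1]
    field_simp
    rw [← pow_mul, mul_comm α 2, pow_mul]
    simp
  rw [h3, mul_pow _ I, pow_succ, pow_succ]
  field_simp

theorem cotangent_type_sum_eq_rational_function
    (g : ℕ → ℂ → ℂ)
    (hg0 : ∀ w : ℂ, g 0 w = (w + 1) / (w - 1))
    (hgs : ∀ m : ℕ, ∀ w : ℂ, g (m + 1) w = w * deriv (g m) w)
    (α : ℕ) (hα : 1 ≤ α)
    (x : ℝ) (hx : ∀ m : ℤ, x ≠ 2 * π * m) :
    Summable (fun k : ℤ => |1 / (x + 2 * π * k) ^ (α + 1)|) ∧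
    (∑' k : ℤ, (1 : ℂ) / (((x : ℂ) + 2 * π * k) ^ (α + 1))) =
      Complex.I ^ (α + 1) / 2 * ((-1) ^ α / (α.factorial : ℂ)) *
        g α (Complex.exp (x * Complex.I)) := by
  have hpi := Real.pi_pos
  have hne : ∀ k : ℤ, x + 2 * π * k ≠ 0 := by
    intro k h
    apply hx (-k)
    push_cast
    linarith
  have hsum : Summable (fun k : ℤ => |1 / (x + 2 * π * k) ^ (α + 1)|) := by
    have h := (Real.summable_one_div_int_add_rpow (x / (2 * π)) ((α + 1 : ℕ) : ℝ)).mpr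
      (by exact_mod_cast (by omega : 1 < α + 1))
    refine (h.mul_left (1 / (2 * π) ^ (α + 1))).congr fun k => ?_
    rw [Real.rpow_natCast, abs_div, abs_one, abs_pow, one_div_mul_one_div, ← mul_pow]
    congr 2
    rw [← abs_of_pos (show 0 < 2 * π by positivity), ← abs_mul, abs_of_pos (show 0 < 2 * π by positivity)]
    congr 1
    field_simp
    ring
  refine ⟨hsum, ?_⟩
  have hexp : Complex.exp (x * I) ≠ 1 := by
    intro h
    rw [Complex.exp_eq_one_iff] at h
    obtain ⟨n, hn⟩ := h
    apply hx n
    have : (x : ℂ) = 2 * π * n := by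
      apply mul_right_cancel₀ Complex.I_ne_zero
      rw [hn]; ring
    exact_mod_cast this
  have hgc : ContinuousAt (g α) (Complex.exp (x * I)) :=
    ((aux_g_diff g hg0 hgs α).differentiableAt
        (isOpen_compl_singleton.mem_nhds hexp)).continuousAt
  have hz0 : Filter.Tendsto (fun y : ℝ => (x : ℂ) + y * I) (nhdsWithin 0 (Set.Ioi 0))
      (nhds (x : ℂ)) := by
    have : Continuous (fun y : ℝ => (x : ℂ) + y * I) := by fun_prop
    have h := this.tendsto 0
    simp only [Complex.ofReal_zero, zero_mul, add_zero] at h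
    exact h.mono_left nhdsWithin_le_nhds
  have hR : Filter.Tendsto (fun y : ℝ => Complex.I ^ (α + 1) / 2 * ((-1) ^ α / (α.factorial : ℂ)) *
        g α (Complex.exp (((x : ℂ) + y * I) * Complex.I))) (nhdsWithin 0 (Set.Ioi 0))
      (nhds (Complex.I ^ (α + 1) / 2 * ((-1) ^ α / (α.factorial : ℂ)) *
        g α (Complex.exp (x * Complex.I)))) := by
    apply Filter.Tendsto.const_mul
    apply hgc.tendsto.comp
    exact (Complex.continuous_exp.tendsto _).comp (hz0.mul_const I)
  have hL : Filter.Tendsto (fun y : ℝ => ∑' k : ℤ, (1 : ℂ) /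
        ((((x : ℂ) + y * I) + 2 * π * k) ^ (α + 1))) (nhdsWithin 0 (Set.Ioi 0))
      (nhds (∑' k : ℤ, (1 : ℂ) / (((x : ℂ) + 2 * π * k) ^ (α + 1)))) := by
    refine tendsto_tsum_of_dominated_convergence hsum ?_ ?_
    · intro k
      have hk : ((x : ℂ) + 2 * π * k) ≠ 0 := by exact_mod_cast hne k
      exact tendsto_const_nhds.div ((hz0.add_const _).pow _) (pow_ne_zero _ hk)
    · refine Filter.Eventually.of_forall fun y k => ?_
      rw [norm_div, norm_one, norm_pow, abs_div, abs_one, abs_pow]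
      have hpos : 0 < |x + 2 * π * k| := abs_pos.mpr (hne k)
      have : |x + 2 * π * k| ≤ ‖(x : ℂ) + y * I + 2 * π * k‖ := by
        have := Complex.abs_re_le_norm ((x : ℂ) + y * I + 2 * π * k)
        simpa using this
      gcongr
  refine tendsto_nhds_unique hL (hR.congr' ?_)
  filter_upwards [self_mem_nhdsWithin] with y hy
  exact (aux_upper g hg0 hgs α hα _ (by simpa using hy)).symm
end

section
/- Let n ≥ 1 and let x be a unit vector in ℂⁿ with x ≠ e_n, where e_n is the last standard basis vector. Then there exists a unique n×n complex unitary matrix R such that R·e_n = x and R − I has rank one. -/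
open Matrix

theorem rank_one_completion_aux {n : ℕ} (i : Fin n) (x : Fin n → ℂ)
    (hx : ∑ k, star (x k) * x k = 1) (hxe : x ≠ Pi.single i 1) :
    ∃! R : Matrix (Fin n) (Fin n) ℂ,
      R ∈ Matrix.unitaryGroup (Fin n) ℂ ∧
      R.mulVec (Pi.single i 1) = x ∧
      (R - 1).rank = 1 := by
  obtain ⟨v, hv⟩ : ∃ v : Fin n → ℂ, v = x - Pi.single i 1 := ⟨_, rfl⟩
  have hv0 : v ≠ 0 := by
    rw [hv]; exact sub_ne_zero.mpr hxe
  have hvk : ∀ k, v k = x k - (1 : Matrix (Fin n) (Fin n) ℂ) k i := by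
    intro k; simp [hv, Matrix.one_apply, Pi.single_apply]
  obtain ⟨s, hs⟩ : ∃ s : ℂ, s = star (x i) - 1 := ⟨_, rfl⟩
  have hss : star s = x i - 1 := by simp [hs]
  have hxv : ∑ k, star (x k) * v k = -s := by
    simp only [hvk, mul_sub, Finset.sum_sub_distrib, hx]
    simp [Matrix.one_apply, hs]
  have hvv : ∑ k, star (v k) * v k = -(s + star s) := by
    have : ∀ k, star (v k) * v k
        = star (x k) * v k - (1 : Matrix (Fin n) (Fin n) ℂ) k i * v k := by
      intro k
      rw [← sub_mul]; congr 1
      by_cases hki : k = i <;> simp [hvk, Matrix.one_apply, hki]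
    simp only [this, Finset.sum_sub_distrib, hxv]
    simp [Matrix.one_apply, hss, hv]
    ring
  have hs0 : s ≠ 0 := by
    intro h0
    apply hv0
    rw [h0] at hvv
    have : star v ⬝ᵥ v = 0 := by simpa [dotProduct] using hvv
    open ComplexOrder in exact dotProduct_star_self_eq_zero.mp this
  have hs0' : star s ≠ 0 := star_ne_zero.mpr hs0
  have hcol : ∀ R : Matrix (Fin n) (Fin n) ℂ, R.mulVec (Pi.single i 1) = R.col i := by
    intro R; simp
  refine ⟨1 + vecMulVec v (fun j => star (v j) / s), ⟨?_, ?_, ?_⟩, ?_⟩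
  · rw [Matrix.mem_unitaryGroup_iff']
    ext a b
    rw [star_eq_conjTranspose, conjTranspose_add, conjTranspose_one, add_mul, one_mul, mul_add,
      mul_one]
    have h1 : ((vecMulVec v (fun j => star (v j) / s))ᴴ * vecMulVec v (fun j => star (v j) / s)) a b
        = v a / star s * (star (v b) / s) * (-(s + star s)) := by
      rw [← hvv, Finset.mul_sum, Matrix.mul_apply]
      refine Finset.sum_congr rfl fun k _ => ?_
      simp only [conjTranspose_apply, vecMulVec_apply, star_mul', star_div₀, star_star]
      ring
    simp only [Matrix.add_apply, h1]
    simp only [conjTranspose_apply, vecMulVec_apply, star_mul', star_div₀, star_star]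
    field_simp
    ring
  · rw [hcol]
    ext k
    have : star (v i) = s := by simp [hvk, hs]
    simp only [Matrix.col_apply, Matrix.add_apply, vecMulVec_apply, this, div_self hs0]
    rw [hvk]
    ring
  · rw [add_sub_cancel_left]
    apply le_antisymm (rank_vecMulVec_le _ _)
    rw [Nat.one_le_iff_ne_zero, Ne]
    intro h0
    have h := LinearMap.range_eq_bot.mp (Submodule.finrank_eq_zero.mp h0)
    apply hv0
    ext k
    have := congrFun (LinearMap.congr_fun h (Pi.single k 1)) k
    simpa [vecMulVec_apply, hs0] using this
  · rintro R ⟨hU, hRx, hr⟩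
    have hRk : ∀ k, R k i = x k := by
      intro k; rw [← hRx, hcol]; rfl
    have hvr : (R - 1).mulVecLin (Pi.single i 1) = v := by
      rw [Matrix.mulVecLin_apply, hcol]
      ext k; simp [hRk, hvk]
    have hw : ∀ j, ∃ c : ℂ, c • v = (R - 1).col j := by
      intro j
      have h := (finrank_eq_one_iff_of_nonzero'
        (⟨v, ⟨_, hvr⟩⟩ : LinearMap.range (R - 1).mulVecLin)
        (by intro h; exact hv0 (congrArg Subtype.val h))).mp hr
      obtain ⟨c, hc⟩ := h ⟨(R - 1).col j, ⟨Pi.single j 1, by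
        rw [Matrix.mulVecLin_apply, Matrix.mulVec_single_one]⟩⟩
      exact ⟨c, congrArg Subtype.val hc⟩
    choose w hw using hw
    have hR : ∀ k j, R k j = (1 : Matrix (Fin n) (Fin n) ℂ) k j + w j * v k := by
      intro k j
      have := congrFun (hw j) k
      simp only [Pi.smul_apply, smul_eq_mul, Matrix.col_apply, Matrix.sub_apply] at this
      rw [this]; ring
    rw [Matrix.mem_unitaryGroup_iff'] at hU
    ext k j
    have h := congrFun (congrFun hU i) j
    rw [Matrix.mul_apply] at h
    simp only [star_apply, hRk, hR _ j, mul_add, Finset.sum_add_distrib] at h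
    have h2 : ∑ k, star (x k) * (w j * v k) = w j * (-s) := by
      rw [← hxv, Finset.mul_sum]
      exact Finset.sum_congr rfl fun k _ => by ring
    have h3 : ∑ k, star (x k) * (1 : Matrix (Fin n) (Fin n) ℂ) k j = star (x j) := by
      simp [Matrix.one_apply]
    rw [h2, h3] at h
    have h4 : star (v j) = star (x j) - (1 : Matrix (Fin n) (Fin n) ℂ) i j := by
      by_cases hij : j = i
      · subst hij; simp [hvk]
      · simp [hvk, Matrix.one_apply, hij, Ne.symm hij]
    have h5 : w j = star (v j) / s := by
      rw [eq_div_iff hs0, h4, ← h]; ring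
    rw [hR, h5, Matrix.add_apply, vecMulVec_apply]
    ring

theorem exists_unique_rank_one_completion (n : ℕ) (hn : 1 ≤ n)
    (x : EuclideanSpace ℂ (Fin n)) (hx : ‖x‖ = 1)
    (hxe : x ≠ EuclideanSpace.single (⟨n - 1, by omega⟩ : Fin n) 1) :
    ∃! R : Matrix (Fin n) (Fin n) ℂ,
      R ∈ Matrix.unitaryGroup (Fin n) ℂ ∧
      R.mulVec (Pi.single (⟨n - 1, by omega⟩ : Fin n) 1) = ⇑x ∧
      (R - 1).rank = 1 := by
  apply rank_one_completion_aux
  · have h : ∑ k, ‖x k‖ ^ 2 = 1 := by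
      rw [← EuclideanSpace.norm_sq_eq, hx]; norm_num
    have h2 : ∀ k, star (x k) * x k = ((‖x k‖ ^ 2 : ℝ) : ℂ) := by
      intro k
      have := Complex.conj_mul' (x k)
      simpa using this
    simp only [h2]
    rw [← Complex.ofReal_sum, h]; simp
  · intro h
    apply hxe
    ext k
    rw [h]
    simp [Pi.single_apply]
end
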